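/- arXiv:1504.08176 — 3 statements merged into one kernel-verified Lean document; each statement's English description precedes it below -/
import Mathlib

section
/- Let M be a finitely generated R-module with projective presentation P_1 →f P_0 → M → 0, and let tr_ω M := coker(f† : P_0† → P_1†) be the ω-transpose of M. Then ker δ_M ≅ Ext^1_R(tr_ω M, ω), where δ_M : M → M†† is the natural evaluation homomorphism. -/
open CategoryTheory

noncomputable section

/-- `Ext^n_A(M, N)` as a module. -/
def ext1 (A : Type) [CommRing A] (n : ℕ) (M N : Type) [AddCommGroup M] [Module A M]
    [AddCommGroup N] [Module A N] : ModuleCat A :=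
  ((Ext A (ModuleCat A) n).obj (Opposite.op (ModuleCat.of A M))).obj (ModuleCat.of A N)

/-- The depth of a module over a local ring: the least `n` with `Ext^n(k, M) ≠ 0`
(`⊤` if no such `n`, e.g. for the zero module). -/
def rdepth (A : Type) [CommRing A] [IsLocalRing A] (M : Type) [AddCommGroup M] [Module A M] :
    ℕ∞ :=
  sInf {n : ℕ∞ | ∃ m : ℕ, n = m ∧ ¬ Subsingleton (ext1 A m (IsLocalRing.ResidueField A) M)}

/-- The dimension of a module, `dim M = dim (A / ann M)`. -/
def mdim (A : Type) [CommRing A] (M : Type) [AddCommGroup M] [Module A M] : WithBot ℕ∞ :=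
  ringKrullDim (A ⧸ Module.annihilator A M)

/-- `cod M > n`, i.e. `dim A - dim M > n`, i.e. `dim M + n < d`. -/
def codGT (A : Type) [CommRing A] (d : ℕ) (M : Type) [AddCommGroup M] [Module A M]
    (n : ℕ) : Prop :=
  mdim A M + n < (d : WithBot ℕ∞)

/-- `cod M ≥ n`, i.e. `dim M + n ≤ d`. -/
def codGE (A : Type) [CommRing A] (d : ℕ) (M : Type) [AddCommGroup M] [Module A M]
    (n : ℕ) : Prop :=
  mdim A M + n ≤ (d : WithBot ℕ∞)

/-- Maximal Cohen-Macaulay module over a `d`-dimensional local ring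
(the zero module counts as MCM). -/
def IsMCM (A : Type) [CommRing A] [IsLocalRing A] (d : ℕ) (M : Type) [AddCommGroup M]
    [Module A M] : Prop :=
  Module.Finite A M ∧ (d : ℕ∞) ≤ rdepth A M

/-- Serre's condition `(S_n)`: `depth M_p ≥ min {n, ht p}` for all primes `p`. -/
def SerreS (A : Type) [CommRing A] (n : ℕ) (M : Type) [AddCommGroup M] [Module A M] : Prop :=
  ∀ p : PrimeSpectrum A,
    min (n : WithBot ℕ∞) (ringKrullDim (Localization.AtPrime p.asIdeal))
      ≤ (rdepth (Localization.AtPrime p.asIdeal)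
          (LocalizedModule p.asIdeal.primeCompl M) : ℕ∞)

/-- Finite injective dimension: `Ext^m(-, M)` vanishes for all large `m`. -/
def HasFID (A : Type) [CommRing A] (M : Type) [AddCommGroup M] [Module A M] : Prop :=
  ∃ n : ℕ, ∀ (N : Type) [AddCommGroup N] [Module A N], ∀ m : ℕ, n < m →
    Subsingleton (ext1 A m N M)

/-- `ω` is a canonical module of the `d`-dimensional local ring `A`:
it is maximal Cohen-Macaulay, of finite injective dimension, and of type one. -/
def IsCanonicalModule (A : Type) [CommRing A] [IsLocalRing A] (d : ℕ) (ω : Type)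
    [AddCommGroup ω] [Module A ω] : Prop :=
  IsMCM A d ω ∧ HasFID A ω ∧
    Nonempty ((ext1 A d (IsLocalRing.ResidueField A) ω) ≃ₗ[A] IsLocalRing.ResidueField A)

/-- `μ : M → X` is a CM-preenvelope. -/
def IsCMPreenvelope (A : Type) [CommRing A] [IsLocalRing A] (d : ℕ) {M X : Type}
    [AddCommGroup M] [Module A M] [AddCommGroup X] [Module A X] (μ : M →ₗ[A] X) : Prop :=
  IsMCM A d X ∧ ∀ (Z : Type) [AddCommGroup Z] [Module A Z], IsMCM A d Z →
    ∀ f : M →ₗ[A] Z, ∃ g : X →ₗ[A] Z, g ∘ₗ μ = f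

/-- `μ : M → X` is a special CM-preenvelope: a CM-preenvelope with
`Ext^1(coker μ, Z) = 0` for all maximal Cohen-Macaulay `Z`. -/
def IsSpecialCMPreenvelope (A : Type) [CommRing A] [IsLocalRing A] (d : ℕ) {M X : Type}
    [AddCommGroup M] [Module A M] [AddCommGroup X] [Module A X] (μ : M →ₗ[A] X) : Prop :=
  IsCMPreenvelope A d μ ∧ ∀ (Z : Type) [AddCommGroup Z] [Module A Z], IsMCM A d Z →
    Subsingleton (ext1 A 1 (X ⧸ LinearMap.range μ) Z)

/-- `μ : M → X` is a CM-envelope. -/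
def IsCMEnvelope (A : Type) [CommRing A] [IsLocalRing A] (d : ℕ) {M X : Type}
    [AddCommGroup M] [Module A M] [AddCommGroup X] [Module A X] (μ : M →ₗ[A] X) : Prop :=
  IsCMPreenvelope A d μ ∧ ∀ φ : X →ₗ[A] X, φ ∘ₗ μ = μ → Function.Bijective φ

/-- `π : X → M` is a CM-precover. -/
def IsCMPrecover (A : Type) [CommRing A] [IsLocalRing A] (d : ℕ) {X M : Type}
    [AddCommGroup X] [Module A X] [AddCommGroup M] [Module A M] (π : X →ₗ[A] M) : Prop :=
  IsMCM A d X ∧ ∀ (Z : Type) [AddCommGroup Z] [Module A Z], IsMCM A d Z →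
    ∀ f : Z →ₗ[A] M, ∃ g : Z →ₗ[A] X, π ∘ₗ g = f

/-- `π : X → M` is a special CM-precover: a CM-precover with
`Ext^1(Z, ker π) = 0` for all maximal Cohen-Macaulay `Z`. -/
def IsSpecialCMPrecover (A : Type) [CommRing A] [IsLocalRing A] (d : ℕ) {X M : Type}
    [AddCommGroup X] [Module A X] [AddCommGroup M] [Module A M] (π : X →ₗ[A] M) : Prop :=
  IsCMPrecover A d π ∧ ∀ (Z : Type) [AddCommGroup Z] [Module A Z], IsMCM A d Z →
    Subsingleton (ext1 A 1 Z ↥(LinearMap.ker π))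

/-- `π : X → M` is a CM-cover. -/
def IsCMCover (A : Type) [CommRing A] [IsLocalRing A] (d : ℕ) {X M : Type}
    [AddCommGroup X] [Module A X] [AddCommGroup M] [Module A M] (π : X →ₗ[A] M) : Prop :=
  IsCMPrecover A d π ∧ ∀ φ : X →ₗ[A] X, π ∘ₗ φ = π → Function.Bijective φ

/-- `M` has no nonzero free direct summand. -/
def NoNonzeroFreeSummand (A : Type) [CommRing A] (M : Type) [AddCommGroup M]
    [Module A M] : Prop :=
  ∀ F G : Submodule A M, IsCompl F G → Module.Free A ↥F → F = ⊥

/-- `W` belongs to `add ω`: it is a direct summand of a finite direct sum of copies of `ω`. -/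
def InAdd (A : Type) [CommRing A] (ω : Type) [AddCommGroup ω] [Module A ω] (W : Type)
    [AddCommGroup W] [Module A W] : Prop :=
  ∃ (n : ℕ) (W' : ModuleCat.{0} A), Nonempty ((W × ↥W') ≃ₗ[A] (Fin n → ω))

section delta

variable (A : Type) [CommRing A] (ω : Type) [AddCommGroup ω] [Module A ω]

/-- The natural evaluation map `δ_M : M → M†† = Hom(Hom(M, ω), ω)`. -/
def deltaMap (M : Type) [AddCommGroup M] [Module A M] :
    M →ₗ[A] ((M →ₗ[A] ω) →ₗ[A] ω) :=
  (LinearMap.id : (M →ₗ[A] ω) →ₗ[A] (M →ₗ[A] ω)).flip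

/-- The dual `f† = Hom(f, ω)` of a linear map `f`. -/
def dmap {M N : Type} [AddCommGroup M] [Module A M] [AddCommGroup N] [Module A N]
    (f : M →ₗ[A] N) : (N →ₗ[A] ω) →ₗ[A] (M →ₗ[A] ω) :=
  LinearMap.lcomp A ω f

end delta

/-- The homology `ker g / im f` at the middle spot of `M → N → P`. -/
abbrev homMod (A : Type) [CommRing A] {M N P : Type} [AddCommGroup M] [Module A M]
    [AddCommGroup N] [Module A N] [AddCommGroup P] [Module A P]
    (f : M →ₗ[A] N) (g : N →ₗ[A] P) : Type :=
  ↥(LinearMap.ker g) ⧸ Submodule.comap (LinearMap.ker g).subtype (LinearMap.range f)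

end

namespace CategoryTheory.ProjectiveResolution

variable {R : Type} [CommRing R] {X Y : ModuleCat.{0} R} (P : ProjectiveResolution X)

lemma smul_extMk {n : ℕ} (r : R) (f : P.complex.X n ⟶ Y) (m : ℕ) (hm : n + 1 = m)
    (hf : P.complex.d m n ≫ f = 0) :
    r • P.extMk f m hm hf = P.extMk (r • f) m hm (by rw [Linear.comp_smul, hf, smul_zero]) := by
  rw [Abelian.Ext.smul_eq_comp_mk₀, P.extMk_comp_mk₀]
  congr 1

lemma extMk_zero_eq_zero_iff (f : P.complex.X 0 ⟶ Y) (hf : P.complex.d 1 0 ≫ f = 0) :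
    P.extMk f 1 rfl hf = 0 ↔ f = 0 := by
  refine ⟨fun h => ?_, fun h => by subst h; exact P.extMk_zero _ _⟩
  rw [← P.extEquivCohomologyClass.apply_eq_iff_eq, P.extEquivCohomologyClass_extMk,
    P.extEquivCohomologyClass_zero, CochainComplex.HomComplex.CohomologyClass.mk_eq_zero_iff,
    CochainComplex.HomComplex.Cocycle.toSingleMk_mem_coboundaries_iff _ _ _ _ _ 1 (by simp)] at h
  obtain ⟨g, hg⟩ := h
  have h0 : P.cochainComplex.d (-((0 : ℕ) : ℤ)) 1 = 0 :=
    (P.cochainComplex.isZero_of_isStrictlyLE 0 1 (by simp)).eq_of_tgt _ _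
  rw [h0, Limits.zero_comp] at hg
  rw [← cancel_epi (P.cochainComplexXIso (-((0 : ℕ) : ℤ)) 0 rfl).hom, ← hg, Limits.comp_zero]

/-- Sending a cocycle to its class in `Ext`, as a linear map. -/
noncomputable def extMkLinearMap (Y : ModuleCat.{0} R) (n : ℕ) :
    LinearMap.ker ((P.complex.linearYonedaObj R Y).d n (n + 1)).hom →ₗ[R] Abelian.Ext X Y n where
  toFun f := P.extMk f.1 (n + 1) rfl f.2
  map_add' _ _ := (P.add_extMk _ _ _ _ _ _).symm
  map_smul' r _ := (P.smul_extMk r _ _ _ _).symm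

lemma extMkLinearMap_surjective (Y : ModuleCat.{0} R) (n : ℕ) :
    Function.Surjective (P.extMkLinearMap Y n) := fun α => by
  obtain ⟨f, hf, rfl⟩ := P.extMk_surjective α (n + 1) rfl
  exact ⟨⟨f, hf⟩, rfl⟩

lemma ker_extMkLinearMap_zero (Y : ModuleCat.{0} R) :
    LinearMap.ker (P.extMkLinearMap Y 0) =
      LinearMap.range ((P.complex.linearYonedaObj R Y).sc' 0 0 1).moduleCatToCycles := by
  ext ⟨f, hf⟩
  refine (P.extMk_zero_eq_zero_iff f hf).trans ⟨fun h => ⟨0, ?_⟩, ?_⟩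
  · subst h
    simp; rfl
  · rintro ⟨g, hg⟩
    have : ((P.complex.linearYonedaObj R Y).d 0 0).hom g = f := congrArg Subtype.val hg
    rw [HomologicalComplex.shape _ _ _ (by simp)] at this
    exact this.symm

lemma ker_extMkLinearMap_succ (Y : ModuleCat.{0} R) (n : ℕ) :
    LinearMap.ker (P.extMkLinearMap Y (n + 1)) =
      LinearMap.range
        ((P.complex.linearYonedaObj R Y).sc' n (n + 1) (n + 1 + 1)).moduleCatToCycles := by
  ext ⟨f, hf⟩
  refine (P.extMk_eq_zero_iff f _ rfl hf n rfl).trans ⟨?_, ?_⟩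
  · rintro ⟨g, hg⟩
    exact ⟨g, Subtype.ext hg⟩
  · rintro ⟨g, hg⟩
    exact ⟨g, congrArg Subtype.val hg⟩

end CategoryTheory.ProjectiveResolution

lemma CategoryTheory.ShortComplex.nonempty_homology_linearEquiv {R : Type} [CommRing R]
    (S : ShortComplex (ModuleCat.{0} R)) {N : Type*} [AddCommGroup N] [Module R N]
    (f : LinearMap.ker S.g.hom →ₗ[R] N) (hf : Function.Surjective f)
    (hker : LinearMap.ker f = LinearMap.range S.moduleCatToCycles) :
    Nonempty (S.homology ≃ₗ[R] N) :=
  ⟨S.moduleCatHomologyIso.toLinearEquiv ≪≫ₗ Submodule.quotEquivOfEq _ _ hker.symm ≪≫ₗ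
    f.quotKerEquivOfSurjective hf⟩

lemma nonempty_ext1_linearEquiv {R : Type} [CommRing R] (n : ℕ) (M N : Type) [AddCommGroup M]
    [Module R M] [AddCommGroup N] [Module R N] :
    Nonempty (ext1 R n M N ≃ₗ[R] Abelian.Ext (ModuleCat.of R M) (ModuleCat.of R N) n) := by
  let P := projectiveResolution (ModuleCat.of R M)
  let Y := ModuleCat.of R N
  cases n with
  | zero =>
    obtain ⟨e⟩ := ShortComplex.nonempty_homology_linearEquiv
      ((P.complex.linearYonedaObj R Y).sc' 0 0 1) (P.extMkLinearMap Y 0)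
      (P.extMkLinearMap_surjective Y 0) (P.ker_extMkLinearMap_zero Y)
    exact ⟨(P.isoExt 0 Y ≪≫ (P.complex.linearYonedaObj R Y).homologyIsoSc' 0 0 1 (by simp)
      (by simp)).toLinearEquiv ≪≫ₗ e⟩
  | succ n =>
    obtain ⟨e⟩ := ShortComplex.nonempty_homology_linearEquiv
      ((P.complex.linearYonedaObj R Y).sc' n (n + 1) (n + 1 + 1)) (P.extMkLinearMap Y (n + 1))
      (P.extMkLinearMap_surjective Y (n + 1)) (P.ker_extMkLinearMap_succ Y n)
    exact ⟨(P.isoExt (n + 1) Y ≪≫ (P.complex.linearYonedaObj R Y).homologyIsoSc' n (n + 1)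
      (n + 1 + 1) (by simp) (by simp)).toLinearEquiv ≪≫ₗ e⟩

section

open Abelian IsLocalRing

variable {R : Type} [CommRing R]

lemma Function.Exact.shortExact_moduleCat {M N P : Type} [AddCommGroup M] [Module R M]
    [AddCommGroup N] [Module R N] [AddCommGroup P] [Module R P] {f : M →ₗ[R] N} {g : N →ₗ[R] P}
    (h : Function.Exact f g) (hf : Function.Injective f) (hg : Function.Surjective g) :
    (ShortComplex.mk (ModuleCat.ofHom f) (ModuleCat.ofHom g)
      (ModuleCat.hom_ext h.linearMap_comp_eq_zero)).ShortExact where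
  exact := (ShortComplex.moduleCat_exact_iff_ker_sub_range _).mpr h.linearMap_ker_eq.le
  mono_f := (ModuleCat.mono_iff_injective _).mpr hf
  epi_g := (ModuleCat.epi_iff_surjective _).mpr hg

lemma subsingleton_ext_X₂_contravariant {S : ShortComplex (ModuleCat.{0} R)} (hS : S.ShortExact)
    (Y : ModuleCat.{0} R) (n : ℕ) [Subsingleton (Abelian.Ext S.X₁ Y n)]
    [Subsingleton (Abelian.Ext S.X₃ Y n)] : Subsingleton (Abelian.Ext S.X₂ Y n) := by
  refine subsingleton_of_forall_eq 0 fun x => ?_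
  obtain ⟨y, rfl⟩ := Ext.contravariant_sequence_exact₂ hS Y x (Subsingleton.elim _ _)
  rw [Subsingleton.elim y 0, Ext.comp_zero]

lemma precompOfLinear_mk₀_injective {X₁ X₂ : ModuleCat.{0} R} (f : X₁ ⟶ X₂) [IsIso f]
    (Y : ModuleCat.{0} R) (n : ℕ) :
    Function.Injective ((Ext.mk₀ f).precompOfLinear R Y (zero_add n)) := by
  refine (injective_iff_map_eq_zero _).mpr fun x hx => ?_
  have hx : (Ext.mk₀ f).comp x (zero_add n) = 0 := hx
  rw [← Ext.mk₀_id_comp x, ← IsIso.inv_hom_id f, ← Ext.mk₀_comp_mk₀,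
    Ext.comp_assoc_of_second_deg_zero, hx, Ext.comp_zero]

/-- An isomorphism in the first variable induces an isomorphism on `Ext`. -/
lemma nonempty_ext_linearEquiv_of_linearEquiv {M N : Type} [AddCommGroup M] [Module R M]
    [AddCommGroup N] [Module R N] (e : M ≃ₗ[R] N) (Y : ModuleCat.{0} R) (n : ℕ) :
    Nonempty (Abelian.Ext (ModuleCat.of R N) Y n ≃ₗ[R] Abelian.Ext (ModuleCat.of R M) Y n) := by
  refine ⟨LinearEquiv.ofBijective ((Ext.mk₀ e.toModuleIso.hom).precompOfLinear R Y (zero_add n))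
    ⟨precompOfLinear_mk₀_injective _ Y n, fun x =>
      ⟨(Ext.mk₀ e.toModuleIso.inv).comp x (zero_add n), ?_⟩⟩⟩
  change (Ext.mk₀ e.toModuleIso.hom).comp
    ((Ext.mk₀ e.toModuleIso.inv).comp x (zero_add n)) (zero_add n) = x
  rw [← Ext.comp_assoc_of_second_deg_zero, Ext.mk₀_comp_mk₀, e.toModuleIso.hom_inv_id,
    Ext.mk₀_id_comp]

lemma subsingleton_ext_of_linearEquiv {M N : Type} [AddCommGroup M] [Module R M]
    [AddCommGroup N] [Module R N] (e : M ≃ₗ[R] N) (Y : ModuleCat.{0} R) (n : ℕ)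
    [Subsingleton (Abelian.Ext (ModuleCat.of R N) Y n)] :
    Subsingleton (Abelian.Ext (ModuleCat.of R M) Y n) :=
  (nonempty_ext_linearEquiv_of_linearEquiv e Y n).some.symm.toEquiv.subsingleton

lemma subsingleton_ext_of_subsingleton {M : Type} [AddCommGroup M] [Module R M] [Subsingleton M]
    (Y : ModuleCat.{0} R) (n : ℕ) :
    Subsingleton (Abelian.Ext (ModuleCat.of R M) Y n) := by
  refine subsingleton_of_forall_eq 0 fun x => ?_
  rw [← Ext.mk₀_id_comp x, (ModuleCat.isZero_of_subsingleton _).eq_of_src (𝟙 (ModuleCat.of R M)) 0,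
    Ext.mk₀_zero, Ext.zero_comp]

lemma mk₀_smulShortComplex_f_comp {X Y : ModuleCat.{0} R} (x : R) {n : ℕ}
    (y : Abelian.Ext X Y n) :
    (Ext.mk₀ (X.smulShortComplex x).f).comp y (zero_add n) = x • y := by
  refine (congrArg (fun f : X ⟶ X => (Ext.mk₀ f).comp y (zero_add n))
    (X.smulShortComplex_f_eq_smul_id x)).trans ?_
  rw [Ext.mk₀_smul, Ext.smul_comp, Ext.mk₀_id_comp]

variable [IsLocalRing R] [IsNoetherianRing R]

/-- Nakayama's lemma for multiplication by a regular element on `Ext`. -/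
lemma subsingleton_ext_of_subsingleton_ext_quotSMulTop {N : Type} [AddCommGroup N] [Module R N]
    [Module.Finite R N] {x : R} (hx : x ∈ maximalIdeal R) (reg : IsSMulRegular N x)
    (Y : ModuleCat.{0} R) [Module.Finite R Y] (n : ℕ)
    [Subsingleton (Abelian.Ext (ModuleCat.of R (QuotSMulTop x N)) Y (n + 1))] :
    Subsingleton (Abelian.Ext (ModuleCat.of R N) Y n) := by
  have hS := IsSMulRegular.smulShortComplex_shortExact (M := ModuleCat.of R N) reg
  have hle : (⊤ : Submodule R (Abelian.Ext (ModuleCat.of R N) Y n)) ≤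
      maximalIdeal R • (⊤ : Submodule R (Abelian.Ext (ModuleCat.of R N) Y n)) := by
    rintro z -
    have : Subsingleton (Abelian.Ext
      ((ModuleCat.of R N).smulShortComplex x).X₃ Y (n + 1)) := ‹_›
    obtain ⟨y, hy⟩ := Ext.contravariant_sequence_exact₁ hS Y z (add_comm 1 n)
      (Subsingleton.elim _ _)
    rw [hy.symm.trans (mk₀_smulShortComplex_f_comp x y)]
    exact Submodule.smul_mem_smul hx (Submodule.mem_top)
  have := Submodule.eq_bot_of_le_smul_of_le_jacobson_bot (maximalIdeal R) ⊤
    (Module.Finite.fg_top (R := R) (M := Abelian.Ext (ModuleCat.of R N) Y n)) hle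
    (IsLocalRing.maximalIdeal_le_jacobson _)
  exact (Submodule.subsingleton_iff R).mp (subsingleton_of_bot_eq_top this.symm)

lemma subsingleton_ext_of_isWeaklyRegular {d : ℕ} (Y : ModuleCat.{0} R) [Module.Finite R Y]
    (hY : ∀ (N : Type) [AddCommGroup N] [Module R N] [Module.Finite R N], ∀ i, d < i →
      Subsingleton (Abelian.Ext (ModuleCat.of R N) Y i)) (rs : List R)
    (mem : ∀ r ∈ rs, r ∈ maximalIdeal R) :
    ∀ (N : Type) [AddCommGroup N] [Module R N] [Module.Finite R N],
      RingTheory.Sequence.IsWeaklyRegular N rs → ∀ i, d < i + rs.length →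
      Subsingleton (Abelian.Ext (ModuleCat.of R N) Y i) := by
  induction rs with
  | nil => exact fun N _ _ _ _ i hi => hY N i hi
  | cons x rs ih =>
    intro N _ _ _ reg i hi
    rw [RingTheory.Sequence.isWeaklyRegular_cons_iff] at reg
    have := ih (fun r hr => mem r (List.mem_cons_of_mem _ hr)) (QuotSMulTop x N) reg.2 (i + 1)
      (by simp at hi; omega)
    exact subsingleton_ext_of_subsingleton_ext_quotSMulTop (mem x List.mem_cons_self) reg.1 Y i

end

section

open Abelian IsLocalRing

lemma WithBot.eq_natCast_of_add_natCast_eq {a : WithBot ℕ∞} {m n : ℕ}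
    (h : a + n = ((m + n : ℕ) : WithBot ℕ∞)) : a = m := by
  induction a with
  | bot => exact absurd h (WithBot.bot_ne_coe (a := ((m + n : ℕ) : ℕ∞)))
  | coe a =>
    induction a with
    | top => exact absurd h (fun h => ENat.natCast_ne_top (m + n) (WithBot.coe_injective h.symm))
    | coe a =>
      have : a + n = m + n := by exact_mod_cast h
      rw [Nat.add_right_cancel this]; rfl

variable {R : Type} [CommRing R] [IsLocalRing R]

lemma support_residueField :
    Module.support R (ResidueField R) = PrimeSpectrum.zeroLocus (maximalIdeal R) := by
  have : Module.annihilator R (ResidueField R) = maximalIdeal R := Ideal.annihilator_quotient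
  rw [Module.support_eq_zeroLocus, this]

variable [IsNoetherianRing R]

lemma exists_injective_residueField {N : Type} [AddCommGroup N] [Module R N] [Module.Finite R N]
    (h : Module.supportDim R N = 0) :
    ∃ f : ResidueField R →ₗ[R] N, Function.Injective f := by
  have : Nontrivial N := by simp [← Module.supportDim_ne_bot_iff_nontrivial R, h]
  obtain ⟨p, hp⟩ := associatedPrimes.nonempty R N
  have hmem : (⟨p, hp.isPrime⟩ : PrimeSpectrum R) ∈ Module.support R N := by
    rw [Module.support_eq_zeroLocus]
    exact Submodule.annihilator_top.ge.trans hp.annihilator_le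
  rw [support_of_supportDim_eq_zero _ _ h] at hmem
  have : p = maximalIdeal R := le_antisymm (le_maximalIdeal hp.isPrime.ne_top) hmem
  subst this
  exact ((isAssociatedPrime_iff_exists_injective_linearMap _ _).mp hp).2

/-- Rees' theorem over a local ring, for the residue field. -/
lemma exists_isRegular_of_subsingleton_ext_residueField (d : ℕ) (N : Type) [AddCommGroup N]
    [Module R N] [Module.Finite R N] [Nontrivial N]
    (h : ∀ i < d, Subsingleton
      (Abelian.Ext (ModuleCat.of R (ResidueField R)) (ModuleCat.of R N) i)) :
    ∃ rs : List R, rs.length = d ∧ (∀ r ∈ rs, r ∈ maximalIdeal R) ∧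
      RingTheory.Sequence.IsRegular N rs :=
  ModuleCat.exists_isRegular_of_exists_subsingleton_ext (maximalIdeal R) d (ModuleCat.of R N)
    (lt_top_iff_ne_top.mpr (Submodule.top_ne_ideal_smul_of_le_jacobson_annihilator
      (IsLocalRing.maximalIdeal_le_jacobson _)).symm)
    (ModuleCat.of R (ResidueField R)) support_residueField h

lemma hasProjectiveDimensionLE_quotient {rs : List R} (reg : RingTheory.Sequence.IsRegular R rs)
    (mem : ∀ r ∈ rs, r ∈ maximalIdeal R) :
    HasProjectiveDimensionLE
      (ModuleCat.of R (R ⧸ Ideal.ofList rs • (⊤ : Submodule R R))) rs.length := by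
  rw [← projectiveDimension_le_iff]
  refine (ModuleCat.projectiveDimension_quotient_eq_add_length_of_isWeaklyRegular
    (ModuleCat.of R R) rs reg.1 mem).trans_le ?_
  have : projectiveDimension (ModuleCat.of R R) ≤ 0 := by
    have : HasProjectiveDimensionLE (ModuleCat.of R R) 0 := inferInstance
    exact (projectiveDimension_le_iff _ 0).mpr this
  exact (add_le_add_left this _).trans (zero_add _).le

/-- A module `Y` over a `d`-dimensional Cohen-Macaulay local ring whose injective dimension is
finite has injective dimension at most `d`. -/
lemma subsingleton_ext_of_finite_injectiveDimension {d : ℕ} (hdim : ringKrullDim R = d)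
    (hR : ∀ i < d, Subsingleton
      (Abelian.Ext (ModuleCat.of R (ResidueField R)) (ModuleCat.of R R) i))
    (Y : ModuleCat.{0} R) [Module.Finite R Y] (n : ℕ)
    (hn : ∀ (N : Type) [AddCommGroup N] [Module R N] [Module.Finite R N], ∀ i, d + n < i →
      Subsingleton (Abelian.Ext (ModuleCat.of R N) Y i)) :
    ∀ (N : Type) [AddCommGroup N] [Module R N] [Module.Finite R N], ∀ i, d < i →
      Subsingleton (Abelian.Ext (ModuleCat.of R N) Y i) := by
  obtain ⟨rs, len, mem, reg⟩ := exists_isRegular_of_subsingleton_ext_residueField d R hR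
  have hsd : Module.supportDim R (R ⧸ Ideal.ofList rs • (⊤ : Submodule R R)) = 0 := by
    have h := Module.supportDim_add_length_eq_supportDim_of_isRegular rs reg
    rw [Module.supportDim_self_eq_ringKrullDim, hdim, len] at h
    exact WithBot.eq_natCast_of_add_natCast_eq (m := 0) (by rw [zero_add]; exact h)
  obtain ⟨ι, hι⟩ := exists_injective_residueField hsd
  induction n with
  | zero => exact hn
  | succ n ih =>
    refine ih fun N _ _ _ i hi => ?_
    obtain rfl | hi' := Nat.eq_or_lt_of_le (show d + n + 1 ≤ i from hi)
    swap
    · exact hn N i (by omega)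
    have hk : Subsingleton (Abelian.Ext (ModuleCat.of R (ResidueField R)) Y (d + n + 1)) := by
      have := hasProjectiveDimensionLE_quotient reg mem
      have h2 := HasProjectiveDimensionLT.subsingleton
        (ModuleCat.of R (R ⧸ Ideal.ofList rs • (⊤ : Submodule R R))) (rs.length + 1)
        (d + n + 1) (by omega) Y
      have hS := (LinearMap.exact_map_mkQ_range ι).shortExact_moduleCat hι
        (Submodule.mkQ_surjective _)
      have h3 := hn (_ ⧸ LinearMap.range ι) (d + n + 1 + 1) (by omega)
      refine subsingleton_of_forall_eq 0 fun z => ?_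
      obtain ⟨y, rfl⟩ := Ext.contravariant_sequence_exact₁ hS Y z (add_comm 1 _)
        (h3.elim _ _)
      rw [h2.elim y 0, Ext.comp_zero]
    induction ‹Module.Finite R N› using
      IsNoetherianRing.induction_on_isQuotientEquivQuotientPrime R with
    | subsingleton N => exact subsingleton_ext_of_subsingleton Y _
    | quotient N p e =>
      suffices Subsingleton (Abelian.Ext (ModuleCat.of R (R ⧸ p.1)) Y (d + n + 1)) from
        subsingleton_ext_of_linearEquiv e Y _
      by_cases hp : p.1 = maximalIdeal R
      · rw [hp]; exact hk
      · obtain ⟨x, hx, hxp⟩ := SetLike.exists_of_lt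
          (lt_of_le_of_ne (le_maximalIdeal p.2.ne_top) hp)
        have hreg : IsSMulRegular (R ⧸ p.1) x := by
          refine .of_right_eq_zero_of_smul fun y hy => ?_
          obtain ⟨y, rfl⟩ := Ideal.Quotient.mk_surjective y
          rw [← Ideal.Quotient.mk_eq_mk, ← Submodule.Quotient.mk_smul,
            Submodule.Quotient.mk_eq_zero] at hy
          exact Ideal.Quotient.eq_zero_iff_mem.mpr ((p.2.mem_or_mem hy).resolve_left hxp)
        have := hn (QuotSMulTop x (R ⧸ p.1)) (d + n + 1 + 1) (by omega)
        exact subsingleton_ext_of_subsingleton_ext_quotSMulTop hx hreg Y _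
    | exact N₁ N₂ N₃ f g hf hg hfg h₁ h₃ =>
      exact subsingleton_ext_X₂_contravariant (hfg.shortExact_moduleCat hf hg) Y _

end

section

open Abelian IsLocalRing

variable {R : Type} [CommRing R] [IsLocalRing R]

lemma nonempty_linearEquiv_residueField_of_isSimpleModule (N : Type) [AddCommGroup N] [Module R N]
    [IsSimpleModule R N] : Nonempty (N ≃ₗ[R] ResidueField R) := by
  obtain ⟨I, hI, ⟨e⟩⟩ := isSimpleModule_iff_quot_maximal.mp ‹IsSimpleModule R N›
  obtain rfl := IsLocalRing.eq_maximalIdeal hI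
  exact ⟨e⟩

lemma subsingleton_ext_of_isFiniteLength {Y : ModuleCat.{0} R} {i : ℕ}
    [Subsingleton (Abelian.Ext (ModuleCat.of R (ResidueField R)) Y i)]
    {N : Type} [AddCommGroup N] [Module R N] (hN : IsFiniteLength R N) :
    Subsingleton (Abelian.Ext (ModuleCat.of R N) Y i) := by
  induction hN with
  | of_subsingleton => exact subsingleton_ext_of_subsingleton Y i
  | @of_simple_quotient M _ _ N _ h ih =>
    obtain ⟨e⟩ := nonempty_linearEquiv_residueField_of_isSimpleModule (R := R) (M ⧸ N)
    have := subsingleton_ext_of_linearEquiv e Y i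
    exact subsingleton_ext_X₂_contravariant ((LinearMap.exact_subtype_mkQ N).shortExact_moduleCat
      N.injective_subtype N.mkQ_surjective) Y i

lemma length_ext_of_isFiniteLength {d : ℕ} (Y : ModuleCat.{0} R)
    (hlt : ∀ i < d, Subsingleton (Abelian.Ext (ModuleCat.of R (ResidueField R)) Y i))
    (hgt : Subsingleton (Abelian.Ext (ModuleCat.of R (ResidueField R)) Y (d + 1)))
    (heq : Module.length R (Abelian.Ext (ModuleCat.of R (ResidueField R)) Y d) = 1)
    {N : Type} [AddCommGroup N] [Module R N] (hN : IsFiniteLength R N) :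
    Module.length R (Abelian.Ext (ModuleCat.of R N) Y d) = Module.length R N := by
  induction hN with
  | of_subsingleton =>
    have := subsingleton_ext_of_subsingleton (R := R) (M := ‹Type›) Y d
    rw [Module.length_eq_zero, Module.length_eq_zero]
  | @of_simple_quotient M _ _ N _ h ih =>
    obtain ⟨e⟩ := nonempty_linearEquiv_residueField_of_isSimpleModule (R := R) (M ⧸ N)
    have hS := (LinearMap.exact_subtype_mkQ N).shortExact_moduleCat
      N.injective_subtype N.mkQ_surjective
    have h1 : Module.length R (Abelian.Ext (ModuleCat.of R (M ⧸ N)) Y d) = 1 := by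
      obtain ⟨e'⟩ := nonempty_ext_linearEquiv_of_linearEquiv e Y d
      rw [← heq, e'.length_eq]
    have h2 := subsingleton_ext_of_linearEquiv e Y (d + 1)
    have hinj : Function.Injective
        ((Ext.mk₀ (ModuleCat.ofHom N.mkQ)).precompOfLinear R Y (zero_add d)) := by
      refine (injective_iff_map_eq_zero _).mpr fun x hx => ?_
      have hx : (Ext.mk₀ (ModuleCat.ofHom N.mkQ)).comp x (zero_add d) = 0 := hx
      cases d with
      | zero =>
        have := hS.epi_g
        exact (injective_iff_map_eq_zero _).mp
          (Ext.precomp_mk₀_injective_of_epi Y (ModuleCat.ofHom N.mkQ)) x hx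
      | succ d =>
        have := hlt d (Nat.lt_succ_self d)
        have := subsingleton_ext_of_isFiniteLength (Y := Y) (i := d) h
        obtain ⟨y, rfl⟩ := Ext.contravariant_sequence_exact₃ hS Y x hx (add_comm 1 d)
        rw [this.elim y 0, Ext.comp_zero]
    have hsurj : Function.Surjective
        ((Ext.mk₀ (ModuleCat.ofHom N.subtype)).precompOfLinear R Y (zero_add d)) := fun z =>
      Ext.contravariant_sequence_exact₁ hS Y z (add_comm 1 d) (h2.elim _ _)
    have hexact : Function.Exact
        ((Ext.mk₀ (ModuleCat.ofHom N.mkQ)).precompOfLinear R Y (zero_add d))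
        ((Ext.mk₀ (ModuleCat.ofHom N.subtype)).precompOfLinear R Y (zero_add d)) := by
      refine fun z => ⟨fun hz => Ext.contravariant_sequence_exact₂ hS Y z hz, ?_⟩
      rintro ⟨y, rfl⟩
      change (Ext.mk₀ (ModuleCat.ofHom N.subtype)).comp
        ((Ext.mk₀ (ModuleCat.ofHom N.mkQ)).comp y (zero_add d)) (zero_add d) = 0
      rw [← Ext.comp_assoc_of_second_deg_zero, Ext.mk₀_comp_mk₀]
      have : ModuleCat.ofHom N.subtype ≫ ModuleCat.ofHom N.mkQ = 0 :=
        ModuleCat.hom_ext (LinearMap.exact_subtype_mkQ N).linearMap_comp_eq_zero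
      rw [this, Ext.mk₀_zero, Ext.zero_comp]
    rw [Module.length_eq_add_of_exact _ _ hinj hsurj hexact, ih, h1,
      Module.length_eq_add_of_exact _ _ N.injective_subtype N.mkQ_surjective
        (LinearMap.exact_subtype_mkQ N), Module.length_eq_one R (M ⧸ N), add_comm]

end

section

open Abelian IsLocalRing

variable {R : Type} [CommRing R]

lemma LinearMap.surjective_of_injective_of_length_eq {M N : Type*} [AddCommGroup M] [Module R M]
    [AddCommGroup N] [Module R N] (f : M →ₗ[R] N) (hf : Function.Injective f)
    (h : Module.length R N = Module.length R M) (hM : Module.length R M ≠ ⊤) :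
    Function.Surjective f := by
  have h' := Module.length_eq_add_of_exact f (LinearMap.range f).mkQ hf
    (Submodule.mkQ_surjective _) (LinearMap.exact_map_mkQ_range f)
  rw [h] at h'
  have h0 : Module.length R (N ⧸ LinearMap.range f) = 0 :=
    (WithTop.add_left_cancel hM ((add_zero _).trans h')).symm
  rw [Module.length_eq_zero_iff, Submodule.Quotient.subsingleton_iff] at h0
  exact LinearMap.range_eq_top.mp h0

lemma LinearMap.injective_of_surjective_of_length_eq {M N : Type*} [AddCommGroup M] [Module R M]
    [AddCommGroup N] [Module R N] (f : M →ₗ[R] N) (hf : Function.Surjective f)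
    (h : Module.length R N = Module.length R M) (hN : Module.length R N ≠ ⊤) :
    Function.Injective f := by
  have h' := Module.length_eq_add_of_exact (LinearMap.ker f).subtype f
    (Submodule.injective_subtype _) hf (LinearMap.exact_subtype_ker_map f)
  rw [← h] at h'
  have h0 : Module.length R (LinearMap.ker f) = 0 :=
    (WithTop.add_right_cancel hN ((zero_add _).trans h')).symm
  rw [Module.length_eq_zero_iff, Submodule.subsingleton_iff_eq_bot] at h0
  exact LinearMap.ker_eq_bot.mp h0

lemma nonempty_quotient_linearMap_linearEquiv (W : Type) [AddCommGroup W] [Module R W]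
    {J : Ideal R} (hJ : J ≤ Module.annihilator R W) :
    Nonempty (((R ⧸ J) →ₗ[R] W) ≃ₗ[R] W) := by
  refine ⟨LinearEquiv.ofBijective (LinearMap.applyₗ (1 : R ⧸ J)) ⟨?_, fun w => ?_⟩⟩
  · refine (injective_iff_map_eq_zero _).mpr fun φ hφ => ?_
    ext
    exact hφ
  · have hw : J ≤ LinearMap.ker (LinearMap.toSpanSingleton R W w) := fun a ha => by
      simpa using Module.mem_annihilator.mp (hJ ha) w
    exact ⟨J.liftQ _ hw, one_smul R w⟩

lemma length_ext_zero (N W : Type) [AddCommGroup N] [Module R N] [AddCommGroup W] [Module R W] :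
    Module.length R (Abelian.Ext (ModuleCat.of R N) (ModuleCat.of R W) 0) =
      Module.length R (N →ₗ[R] W) :=
  (Ext.linearEquiv₀.trans (ModuleCat.homLinearEquiv (S := R))).length_eq

lemma isFiniteLength_of_supportDim_eq_zero [IsNoetherianRing R] {I : Ideal R}
    (h : Module.supportDim R (R ⧸ I) = 0) : IsFiniteLength R (R ⧸ I) := by
  rw [Module.supportDim_quotient_eq_ringKrullDim] at h
  have : Ring.KrullDimLE 0 (R ⧸ I) := Ring.krullDimLE_iff.mpr h.le
  have : IsArtinianRing (R ⧸ I) := isArtinianRing_iff_krullDimLE_zero.mpr this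
  exact isFiniteLength_iff_isNoetherian_isArtinian.mpr ⟨inferInstance,
    isArtinian_of_surjective_algebraMap (R := R ⧸ I) Ideal.Quotient.mk_surjective⟩

lemma exists_smul_of_length_linearMap {I : Ideal R} {W : Type} [AddCommGroup W] [Module R W]
    (hI : I ≤ Module.annihilator R W) (hfl : IsFiniteLength R (R ⧸ I))
    (hlen : ∀ (N : Type) [AddCommGroup N] [Module R N], IsFiniteLength R N →
      I ≤ Module.annihilator R N → Module.length R (N →ₗ[R] W) = Module.length R N) :
    (∀ φ : W →ₗ[R] W, ∃ r : R, ∀ w, φ w = r • w) ∧ Module.annihilator R W ≤ I := by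
  set J := Module.annihilator R W with hJ
  obtain ⟨eI⟩ := nonempty_quotient_linearMap_linearEquiv W hI
  obtain ⟨eJ⟩ := nonempty_quotient_linearMap_linearEquiv W hJ.le
  have hfJ : IsFiniteLength R (R ⧸ J) := hfl.of_surjective (Submodule.factor_surjective hI)
  have h1 : Module.length R W = Module.length R (R ⧸ I) :=
    eI.length_eq.symm.trans (hlen _ hfl Ideal.annihilator_quotient.ge)
  have h2 : Module.length R W = Module.length R (R ⧸ J) :=
    eJ.length_eq.symm.trans (hlen _ hfJ (hI.trans Ideal.annihilator_quotient.ge))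
  have hJt := Module.length_ne_top_iff.mpr hfJ
  constructor
  · have h3 := hlen W (Module.length_ne_top_iff.mp (h2 ▸ hJt)) hI
    let g : (R ⧸ J) →ₗ[R] W →ₗ[R] W := J.liftQ (LinearMap.lsmul R W) fun a ha => by
      ext w
      exact Module.mem_annihilator.mp ha w
    have hg : Function.Injective g := LinearMap.ker_eq_bot.mp
      (Submodule.ker_liftQ_eq_bot _ _ _ fun a ha => Module.mem_annihilator.mpr fun w =>
        LinearMap.congr_fun ha w)
    intro φ
    obtain ⟨y, rfl⟩ := g.surjective_of_injective_of_length_eq hg (h3.trans h2) hJt φ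
    obtain ⟨r, rfl⟩ := Submodule.Quotient.mk_surjective _ y
    exact ⟨r, fun w => rfl⟩
  · intro a ha
    have hinj := (Submodule.factor hI).injective_of_surjective_of_length_eq
      (Submodule.factor_surjective hI) (h2.symm.trans h1) hJt
    rw [← Submodule.Quotient.mk_eq_zero (p := I)]
    refine hinj ?_
    rw [map_zero]
    exact (Submodule.Quotient.mk_eq_zero J).mpr ha

end

section

open Abelian IsLocalRing
open scoped Pointwise

variable {R : Type} [CommRing R]

lemma comp_mk₀_smulShortComplex_f_eq_zero {X Y : ModuleCat.{0} R} {x : R}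
    (hx : x ∈ Module.annihilator R X) {n : ℕ} (y : Abelian.Ext X Y n) :
    y.comp (Ext.mk₀ (Y.smulShortComplex x).f) (add_zero n) = 0 :=
  congrArg (fun f => f.hom y) (Ext.postcomp_smul_id_eq_zero_of_mem_annihilator (M := Y) hx n)

lemma subsingleton_ext_quotSMulTop {X : ModuleCat.{0} R} {W : Type} [AddCommGroup W] [Module R W]
    {x : R} (hx : IsSMulRegular W x) (i : ℕ) (h : Subsingleton (Abelian.Ext X (ModuleCat.of R W) i))
    (h' : Subsingleton (Abelian.Ext X (ModuleCat.of R W) (i + 1))) :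
    Subsingleton (Abelian.Ext X (ModuleCat.of R (QuotSMulTop x W)) i) := by
  have hS := IsSMulRegular.smulShortComplex_shortExact (M := ModuleCat.of R W) hx
  refine subsingleton_of_forall_eq 0 fun z => ?_
  obtain ⟨y, rfl⟩ := Ext.covariant_sequence_exact₃ X hS z rfl (h'.elim _ _)
  exact (congrArg (fun y => Ext.comp y _ _) (h.elim y 0)).trans (Ext.zero_comp ..)

/-- Rees' dimension shift: `Ext^n(N, W/xW) ≅ Ext^{n+1}(N, W)`. -/
lemma nonempty_ext_quotSMulTop_linearEquiv {X : ModuleCat.{0} R} {W : Type} [AddCommGroup W]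
    [Module R W] {x : R} (hx : IsSMulRegular W x) (hX : x ∈ Module.annihilator R X) (n : ℕ)
    (h : Subsingleton (Abelian.Ext X (ModuleCat.of R W) n)) :
    Nonempty (Abelian.Ext X (ModuleCat.of R (QuotSMulTop x W)) n ≃ₗ[R]
      Abelian.Ext X (ModuleCat.of R W) (n + 1)) := by
  have hS := IsSMulRegular.smulShortComplex_shortExact (M := ModuleCat.of R W) hx
  refine ⟨LinearEquiv.ofBijective (hS.extClass.postcompOfLinear R X (rfl : n + 1 = n + 1))
    ⟨(injective_iff_map_eq_zero _).mpr fun z hz => ?_, fun z => ?_⟩⟩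
  · obtain ⟨y, rfl⟩ := Ext.covariant_sequence_exact₃ X hS z rfl hz
    exact (congrArg (fun y => Ext.comp y _ _) (h.elim y 0)).trans (Ext.zero_comp ..)
  · exact Ext.covariant_sequence_exact₁ X hS z (comp_mk₀_smulShortComplex_f_eq_zero hX z) rfl

lemma subsingleton_linearMap_of_ext_zero {N W : Type} [AddCommGroup N] [Module R N]
    [AddCommGroup W] [Module R W]
    (h : Subsingleton (Abelian.Ext (ModuleCat.of R N) (ModuleCat.of R W) 0)) :
    Subsingleton (N →ₗ[R] W) :=
  ((Ext.linearEquiv₀ (R := R)).trans (ModuleCat.homLinearEquiv (S := R)) :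
    Abelian.Ext (ModuleCat.of R N) (ModuleCat.of R W) 0 ≃ₗ[R]
      (N →ₗ[R] W)).symm.toEquiv.subsingleton

variable {A W : Type} [AddCommGroup A] [Module R A] [AddCommGroup W] [Module R W]

lemma ker_mkQ_comp_le_annihilator_quotSMulTop {π : R →ₗ[R] A} {x : R}
    (hπ : Function.Surjective π) (hle : LinearMap.ker π ≤ Module.annihilator R W) :
    LinearMap.ker ((x • (⊤ : Submodule R A)).mkQ ∘ₗ π) ≤
      Module.annihilator R (QuotSMulTop x W) := by
  intro a ha
  obtain ⟨y, -, hy⟩ := (Submodule.mem_smul_pointwise_iff_exists _ _ _).mp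
    ((Submodule.Quotient.mk_eq_zero _).mp ha)
  obtain ⟨b, rfl⟩ := hπ y
  have hker : a - x * b ∈ LinearMap.ker π := by
    rw [LinearMap.mem_ker, map_sub, ← smul_eq_mul, map_smul, hy, sub_self]
  refine Module.mem_annihilator.mpr fun w => ?_
  obtain ⟨w, rfl⟩ := Submodule.mkQ_surjective _ w
  rw [← map_smul, ← sub_add_cancel a (x * b), add_smul, Module.mem_annihilator.mp (hle hker),
    zero_add, mul_smul]
  exact (Submodule.Quotient.mk_eq_zero _).mpr
    (Submodule.smul_mem_pointwise_smul _ _ _ Submodule.mem_top)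

lemma mem_ker_mkQ_comp (π : R →ₗ[R] A) (x : R) :
    x ∈ LinearMap.ker ((x • (⊤ : Submodule R A)).mkQ ∘ₗ π) := by
  refine (Submodule.Quotient.mk_eq_zero _).mpr ?_
  rw [← mul_one x, ← smul_eq_mul, map_smul]
  simp only [smul_eq_mul, mul_one]
  exact Submodule.smul_mem_pointwise_smul _ _ _ Submodule.mem_top

variable [IsLocalRing R] [IsNoetherianRing R]

lemma annihilator_le_ker_of_quotSMulTop {π : R →ₗ[R] A} {x : R} (hx : x ∈ maximalIdeal R)
    (hreg : IsSMulRegular W x) (hπ : Function.Surjective π)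
    (hle : LinearMap.ker π ≤ Module.annihilator R W)
    (h : Module.annihilator R (QuotSMulTop x W) ≤
      LinearMap.ker ((x • (⊤ : Submodule R A)).mkQ ∘ₗ π)) :
    Module.annihilator R W ≤ LinearMap.ker π := by
  refine Submodule.le_of_le_smul_of_le_jacobson_bot (IsNoetherian.noetherian _)
    (IsLocalRing.maximalIdeal_le_jacobson _) fun a ha => ?_
  have ha' : a ∈ LinearMap.ker ((x • (⊤ : Submodule R A)).mkQ ∘ₗ π) :=
    h (LinearMap.annihilator_le_of_surjective _ (Submodule.mkQ_surjective _) ha)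
  obtain ⟨y, -, hy⟩ := (Submodule.mem_smul_pointwise_iff_exists _ _ _).mp
    ((Submodule.Quotient.mk_eq_zero _).mp ha')
  obtain ⟨b, rfl⟩ := hπ y
  have hker : a - x * b ∈ LinearMap.ker π := by
    rw [LinearMap.mem_ker, map_sub, ← smul_eq_mul, map_smul, hy, sub_self]
  have hb : b ∈ Module.annihilator R W := by
    refine Module.mem_annihilator.mpr fun w => hreg ?_
    have := Module.mem_annihilator.mp (hle hker) w
    rw [sub_smul, Module.mem_annihilator.mp ha, zero_sub, neg_eq_zero, mul_smul] at this
    exact this.trans (smul_zero x).symm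
  rw [← sub_add_cancel a (x * b)]
  exact Submodule.add_mem_sup hker (Submodule.smul_mem_smul hx hb)

lemma exists_smul_of_quotSMulTop [Module.Finite R W] {x : R} (hx : x ∈ maximalIdeal R)
    (hreg : IsSMulRegular W x)
    (h : ∀ φ : QuotSMulTop x W →ₗ[R] QuotSMulTop x W, ∃ r : R, ∀ w, φ w = r • w)
    (φ : W →ₗ[R] W) : ∃ r : R, ∀ w, φ w = r • w := by
  suffices (⊤ : Submodule R (W →ₗ[R] W)) ≤ LinearMap.range (LinearMap.lsmul R W) by
    obtain ⟨r, rfl⟩ := this (Submodule.mem_top (x := φ))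
    exact ⟨r, fun w => rfl⟩
  refine Submodule.le_of_le_smul_of_le_jacobson_bot Module.Finite.fg_top
    (IsLocalRing.maximalIdeal_le_jacobson _) fun φ _ => ?_
  obtain ⟨r, hr⟩ := h (QuotSMulTop.map x φ)
  have hmem : ∀ w, (φ - LinearMap.lsmul R W r) w ∈ LinearMap.range (LinearMap.lsmul R W x) := by
    intro w
    have h : (Submodule.Quotient.mk (φ w) : QuotSMulTop x W) = Submodule.Quotient.mk (r • w) :=
      hr (Submodule.Quotient.mk w)
    obtain ⟨v, -, hv⟩ := (Submodule.mem_smul_pointwise_iff_exists _ _ _).mp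
      ((Submodule.Quotient.eq _).mp h)
    exact ⟨v, hv⟩
  let e := LinearEquiv.ofInjective (LinearMap.lsmul R W x) hreg
  let ψ : W →ₗ[R] W := e.symm ∘ₗ LinearMap.codRestrict _ _ hmem
  have hψ : φ = LinearMap.lsmul R W r + x • ψ := by
    ext w
    have : x • ψ w = (φ - LinearMap.lsmul R W r) w :=
      congrArg Subtype.val (e.apply_symm_apply (LinearMap.codRestrict _ _ hmem w))
    simp [this]
  rw [hψ]
  exact Submodule.add_mem_sup ⟨r, rfl⟩ (Submodule.smul_mem_smul hx Submodule.mem_top)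

lemma exists_isSMulRegular_of_subsingleton_ext [Module.Finite R A] [Module.Finite R W]
    (hA : Subsingleton (Abelian.Ext (ModuleCat.of R (ResidueField R)) (ModuleCat.of R A) 0))
    (hW : Subsingleton (Abelian.Ext (ModuleCat.of R (ResidueField R)) (ModuleCat.of R W) 0)) :
    ∃ x ∈ maximalIdeal R, IsSMulRegular A x ∧ IsSMulRegular W x := by
  have := subsingleton_linearMap_of_ext_zero hA
  have := subsingleton_linearMap_of_ext_zero hW
  have : Subsingleton (ResidueField R →ₗ[R] A × W) :=
    (LinearMap.prodEquiv R).symm.toEquiv.subsingleton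
  obtain ⟨x, hx, hreg⟩ := IsSMulRegular.subsingleton_linearMap_iff.mp this
  have hk : Module.annihilator R (ResidueField R) = maximalIdeal R := Ideal.annihilator_quotient
  exact ⟨x, hk ▸ hx, Prod.isSMulRegular_iff.mp hreg⟩

end

section

open Abelian IsLocalRing
open scoped Pointwise

variable {R : Type} [CommRing R] [IsLocalRing R]

lemma subsingleton_ext_of_le_rdepth {d : ℕ} {N : Type} [AddCommGroup N] [Module R N]
    (h : (d : ℕ∞) ≤ rdepth R N) (i : ℕ) (hi : i < d) :
    Subsingleton (Abelian.Ext (ModuleCat.of R (ResidueField R)) (ModuleCat.of R N) i) := by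
  obtain ⟨e⟩ := nonempty_ext1_linearEquiv (R := R) i (ResidueField R) N
  by_contra hne
  have : rdepth R N ≤ i := sInf_le ⟨i, rfl, fun h' => hne e.symm.toEquiv.subsingleton⟩
  exact absurd (Nat.cast_le.mp (h.trans this)) (Nat.not_le.mpr hi)

variable [IsNoetherianRing R]

/-- Duality with values in `W` on finite length modules, read off from `Ext^d`, makes every
endomorphism of `W` a homothety and bounds the annihilator of `W`. -/
lemma exists_smul_and_annihilator_le_of_length_ext (d : ℕ) :
    ∀ (A W : Type) [AddCommGroup A] [Module R A] [Module.Finite R A] [AddCommGroup W] [Module R W]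
      [Module.Finite R W] (π : R →ₗ[R] A), Function.Surjective π →
      LinearMap.ker π ≤ Module.annihilator R W → Module.supportDim R A = d →
      (∀ i < d, Subsingleton
        (Abelian.Ext (ModuleCat.of R (ResidueField R)) (ModuleCat.of R A) i)) →
      (∀ i < d, Subsingleton
        (Abelian.Ext (ModuleCat.of R (ResidueField R)) (ModuleCat.of R W) i)) →
      (∀ (N : Type) [AddCommGroup N] [Module R N], IsFiniteLength R N →
        LinearMap.ker π ≤ Module.annihilator R N →
        Module.length R (Abelian.Ext (ModuleCat.of R N) (ModuleCat.of R W) d) =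
          Module.length R N) →
      (∀ φ : W →ₗ[R] W, ∃ r : R, ∀ w, φ w = r • w) ∧
        Module.annihilator R W ≤ LinearMap.ker π := by
  induction d with
  | zero =>
    intro A W _ _ _ _ _ _ π hπ hle hdim _ _ hlen
    refine exists_smul_of_length_linearMap hle (isFiniteLength_of_supportDim_eq_zero ?_)
      fun N _ _ hN hN' => (length_ext_zero N W).symm.trans (hlen N hN hN')
    exact (Module.supportDim_eq_of_equiv (π.quotKerEquivOfSurjective hπ)).trans hdim
  | succ d ih =>
    intro A W _ _ _ _ _ _ π hπ hle hdim hA hW hlen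
    obtain ⟨x, hx, hxA, hxW⟩ := exists_isSMulRegular_of_subsingleton_ext
      (hA 0 d.succ_pos) (hW 0 d.succ_pos)
    obtain ⟨hφ, hann⟩ := ih (QuotSMulTop x A) (QuotSMulTop x W)
      ((x • (⊤ : Submodule R A)).mkQ ∘ₗ π) ((Submodule.mkQ_surjective _).comp hπ)
      (ker_mkQ_comp_le_annihilator_quotSMulTop hπ hle)
      (WithBot.eq_natCast_of_add_natCast_eq (n := 1)
        ((Module.supportDim_quotSMulTop_succ_eq_supportDim hxA hx).trans hdim))
      (fun i hi => subsingleton_ext_quotSMulTop hxA i (hA i (hi.trans d.lt_succ_self))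
        (hA (i + 1) (Nat.succ_lt_succ hi)))
      (fun i hi => subsingleton_ext_quotSMulTop hxW i (hW i (hi.trans d.lt_succ_self))
        (hW (i + 1) (Nat.succ_lt_succ hi)))
      (fun N _ _ hN hN' => by
        have := hW d d.lt_succ_self
        obtain ⟨e⟩ := nonempty_ext_quotSMulTop_linearEquiv (X := ModuleCat.of R N) hxW
          (hN' (mem_ker_mkQ_comp π x)) d (subsingleton_ext_of_isFiniteLength hN)
        exact e.length_eq.trans (hlen N hN ((LinearMap.ker_le_ker_comp _ _).trans hN')))
    exact ⟨exists_smul_of_quotSMulTop hx hxW hφ,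
      annihilator_le_ker_of_quotSMulTop hx hxW hπ hle hann⟩

variable {d : ℕ} {ω : Type} [AddCommGroup ω] [Module R ω]

lemma IsCanonicalModule.subsingleton_ext (hdim : ringKrullDim R = d)
    (hCM : (d : ℕ∞) ≤ rdepth R R) (hω : IsCanonicalModule R d ω) :
    ∀ (N : Type) [AddCommGroup N] [Module R N] [Module.Finite R N], ∀ i, d < i →
      Subsingleton (Abelian.Ext (ModuleCat.of R N) (ModuleCat.of R ω) i) := by
  have : Module.Finite R ω := hω.1.1
  obtain ⟨n, hn⟩ := hω.2.1
  refine subsingleton_ext_of_finite_injectiveDimension hdim (subsingleton_ext_of_le_rdepth hCM)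
    (ModuleCat.of R ω) n fun N _ _ _ i hi => ?_
  obtain ⟨e⟩ := nonempty_ext1_linearEquiv (R := R) i N ω
  have := hn N i (by omega)
  exact e.symm.toEquiv.subsingleton

lemma IsCanonicalModule.exists_smul_and_annihilator_eq_bot (hdim : ringKrullDim R = d)
    (hCM : (d : ℕ∞) ≤ rdepth R R) (hω : IsCanonicalModule R d ω) :
    (∀ φ : ω →ₗ[R] ω, ∃ r : R, ∀ w, φ w = r • w) ∧ Module.annihilator R ω = ⊥ := by
  have : Module.Finite R ω := hω.1.1
  have hlt := subsingleton_ext_of_le_rdepth hω.1.2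
  obtain ⟨e⟩ := nonempty_ext1_linearEquiv (R := R) d (ResidueField R) ω
  obtain ⟨e'⟩ := hω.2.2
  have hs : IsSimpleModule R (ResidueField R) :=
    isSimpleModule_iff_quot_maximal.mpr ⟨_, maximalIdeal.isMaximal R, ⟨LinearEquiv.refl R _⟩⟩
  have heq := (e.symm.trans e').length_eq.trans (Module.length_eq_one R (ResidueField R))
  obtain ⟨h, hann⟩ := exists_smul_and_annihilator_le_of_length_ext d R ω LinearMap.id
    Function.surjective_id (LinearMap.ker_id.trans_le bot_le)
    ((Module.supportDim_self_eq_ringKrullDim ..).trans hdim) (subsingleton_ext_of_le_rdepth hCM) hlt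
    fun N _ _ hN _ => length_ext_of_isFiniteLength (ModuleCat.of R ω) hlt
      (hω.subsingleton_ext hdim hCM (ResidueField R) (d + 1) d.lt_succ_self) heq hN
  exact ⟨h, le_bot_iff.mp (hann.trans LinearMap.ker_id.le)⟩

lemma IsCanonicalModule.subsingleton_ext_self (hdim : ringKrullDim R = d)
    (hCM : (d : ℕ∞) ≤ rdepth R R) (hω : IsCanonicalModule R d ω) :
    Subsingleton (Abelian.Ext (ModuleCat.of R ω) (ModuleCat.of R ω) 1) := by
  have : Module.Finite R ω := hω.1.1
  have hann := (hω.exists_smul_and_annihilator_eq_bot hdim hCM).2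
  have : Nontrivial ω := by
    by_contra h
    rw [not_nontrivial_iff_subsingleton, ← Module.annihilator_eq_top_iff (R := R), hann] at h
    exact bot_ne_top h
  obtain ⟨rs, len, mem, reg⟩ := exists_isRegular_of_subsingleton_ext_residueField d ω
    (subsingleton_ext_of_le_rdepth hω.1.2)
  exact subsingleton_ext_of_isWeaklyRegular (ModuleCat.of R ω) (hω.subsingleton_ext hdim hCM) rs
    mem ω reg.1 1 (by omega)

end

section

open Abelian IsLocalRing

variable {R : Type} [CommRing R] {ω : Type} [AddCommGroup ω] [Module R ω]

lemma LinearMap.exists_comp_eq_of_ker_le_ker {A B C : Type*} [AddCommGroup A] [Module R A]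
    [AddCommGroup B] [Module R B] [AddCommGroup C] [Module R C] {h : A →ₗ[R] B}
    (hh : Function.Surjective h) {φ : A →ₗ[R] C} (hle : LinearMap.ker h ≤ LinearMap.ker φ) :
    ∃ ψ : B →ₗ[R] C, ψ ∘ₗ h = φ := by
  refine ⟨(LinearMap.ker h).liftQ φ hle ∘ₗ (h.quotKerEquivOfSurjective hh).symm, ?_⟩
  ext a
  have : (h.quotKerEquivOfSurjective hh).symm (h a) = Submodule.Quotient.mk a :=
    (LinearEquiv.symm_apply_eq _).mpr rfl
  simp [this]

lemma Module.Basis.eq_sum_smulRight {ι P : Type*} [Fintype ι] [AddCommGroup P] [Module R P]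
    (b : Module.Basis ι R P) (φ : P →ₗ[R] ω) : φ = ∑ i, (b.coord i).smulRight (φ (b i)) := by
  ext p
  conv_lhs => rw [← b.sum_repr p, map_sum]
  simp [LinearMap.sum_apply]

lemma subsingleton_ext_dual {ι P : Type} [Fintype ι] [AddCommGroup P] [Module R P]
    (b : Module.Basis ι R P) (Y : ModuleCat.{0} R) (n : ℕ)
    [Subsingleton (Abelian.Ext (ModuleCat.of R ω) Y n)] :
    Subsingleton (Abelian.Ext (ModuleCat.of R (P →ₗ[R] ω)) Y n) := by
  refine subsingleton_of_forall_eq 0 fun x => ?_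
  have hid : 𝟙 (ModuleCat.of R (P →ₗ[R] ω)) =
      ∑ i, ModuleCat.ofHom (LinearMap.applyₗ (R := R) (M₂ := ω) (b i)) ≫
        ModuleCat.ofHom (LinearMap.smulRightₗ (R := R) (M := ω) (b.coord i)) := by
    ext φ : 2
    refine (b.eq_sum_smulRight φ).trans ?_
    ext p
    simp [ModuleCat.hom_sum]
  rw [← Ext.mk₀_id_comp x, hid, Ext.mk₀_sum, Ext.sum_comp]
  refine Finset.sum_eq_zero fun i _ => ?_
  rw [← Ext.mk₀_comp_mk₀, Ext.comp_assoc_of_second_deg_zero,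
    Subsingleton.elim ((Ext.mk₀ (ModuleCat.ofHom _)).comp x (zero_add n)) 0, Ext.comp_zero]

lemma deltaMap_bijective {ι P : Type} [Fintype ι] [AddCommGroup P] [Module R P]
    (b : Module.Basis ι R P) (hω : ∀ φ : ω →ₗ[R] ω, ∃ r : R, ∀ w, φ w = r • w)
    (hann : Module.annihilator R ω = ⊥) : Function.Bijective (deltaMap R ω P) := by
  refine ⟨(injective_iff_map_eq_zero _).mpr fun p hp => ?_, fun Φ => ?_⟩
  · refine b.forall_coord_eq_zero_iff.mp fun i => ?_
    rw [← Ideal.mem_bot, ← hann, Module.mem_annihilator]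
    exact fun w => LinearMap.congr_fun hp ((b.coord i).smulRight w)
  · choose c hc using fun i => hω (Φ ∘ₗ LinearMap.smulRightₗ (R := R) (M := ω) (b.coord i))
    refine ⟨∑ i, c i • b i, LinearMap.ext fun φ => ?_⟩
    calc φ (∑ i, c i • b i) = ∑ i, Φ ((b.coord i).smulRight (φ (b i))) := by
          rw [map_sum]
          exact Finset.sum_congr rfl fun i _ => (map_smul φ _ _).trans (hc i (φ (b i))).symm
      _ = Φ φ := by rw [← map_sum, ← b.eq_sum_smulRight φ]

lemma exists_surjective_ext_one {A B T : Type} [AddCommGroup A] [Module R A]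
    [AddCommGroup B] [Module R B] [AddCommGroup T] [Module R T] {i : B →ₗ[R] A} {p : A →ₗ[R] T}
    (h : Function.Exact i p) (hi : Function.Injective i) (hp : Function.Surjective p)
    [Subsingleton (Abelian.Ext (ModuleCat.of R A) (ModuleCat.of R ω) 1)] :
    ∃ E : (B →ₗ[R] ω) →ₗ[R] Abelian.Ext (ModuleCat.of R T) (ModuleCat.of R ω) 1,
      Function.Surjective E ∧ ∀ χ, E χ = 0 ↔ ∃ Φ : A →ₗ[R] ω, Φ ∘ₗ i = χ := by
  have hS := h.shortExact_moduleCat hi hp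
  let e : (B →ₗ[R] ω) ≃ₗ[R] Abelian.Ext (ModuleCat.of R B) (ModuleCat.of R ω) 0 :=
    ((Ext.linearEquiv₀ (R := R)).trans (ModuleCat.homLinearEquiv (S := R))).symm
  refine ⟨hS.extClass.precompOfLinear R (ModuleCat.of R ω) (add_zero 1) ∘ₗ e,
    fun x => ?_, fun χ => ⟨fun hχ => ?_, ?_⟩⟩
  · obtain ⟨y, hy⟩ := Ext.contravariant_sequence_exact₃ hS (ModuleCat.of R ω) x
      (‹Subsingleton (Abelian.Ext (ModuleCat.of R A) (ModuleCat.of R ω) 1)›.elim _ _) (add_zero 1)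
    obtain ⟨χ, rfl⟩ := e.surjective y
    exact ⟨χ, hy⟩
  · obtain ⟨y, hy⟩ := Ext.contravariant_sequence_exact₁ hS (ModuleCat.of R ω) (e χ) (add_zero 1) hχ
    obtain ⟨Φ, rfl⟩ := Ext.homEquiv₀.symm.surjective y
    refine ⟨Φ.hom, e.injective ?_⟩
    rw [← hy]
    exact (Ext.mk₀_comp_mk₀ _ _).symm
  · rintro ⟨Φ, rfl⟩
    have : e (Φ ∘ₗ i) = (Ext.mk₀ (ModuleCat.ofHom i)).comp (Ext.mk₀ (ModuleCat.ofHom Φ))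
      (zero_add 0) := (Ext.mk₀_comp_mk₀ _ _).symm
    change hS.extClass.comp (e (Φ ∘ₗ i)) (add_zero 1) = 0
    rw [this]
    exact hS.extClass_comp_assoc (Ext.mk₀ (ModuleCat.ofHom Φ))

variable {M P₀ P₁ : Type} [AddCommGroup M] [Module R M] [AddCommGroup P₀] [Module R P₀]
  [AddCommGroup P₁] [Module R P₁]

lemma nonempty_ker_deltaMap_linearEquiv_ext {f : P₁ →ₗ[R] P₀} {g : P₀ →ₗ[R] M}
    (hfg : Function.Exact f g) (hg : Function.Surjective g)
    (h₀ : Function.Bijective (deltaMap R ω P₀)) (h₁ : Function.Surjective (deltaMap R ω P₁))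
    [Subsingleton (Abelian.Ext (ModuleCat.of R (P₁ →ₗ[R] ω)) (ModuleCat.of R ω) 1)] :
    Nonempty (LinearMap.ker (deltaMap R ω M) ≃ₗ[R] Abelian.Ext
      (ModuleCat.of R ((P₁ →ₗ[R] ω) ⧸ LinearMap.range (dmap R ω f))) (ModuleCat.of R ω) 1) := by
  let B := LinearMap.range (dmap R ω f)
  let ρ : (P₀ →ₗ[R] ω) →ₗ[R] B := (dmap R ω f).rangeRestrict
  have hρ : Function.Surjective ρ := LinearMap.surjective_rangeRestrict _
  obtain ⟨E, hE, hker⟩ := exists_surjective_ext_one (ω := ω) (LinearMap.exact_subtype_mkQ B)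
    B.injective_subtype B.mkQ_surjective
  let δ := LinearEquiv.ofBijective (deltaMap R ω P₀) h₀
  let G : (B →ₗ[R] ω) →ₗ[R] M := g ∘ₗ δ.symm ∘ₗ LinearMap.lcomp R ω ρ
  have hδ : ∀ (χ : B →ₗ[R] ω) (φ : P₀ →ₗ[R] ω), φ (δ.symm (χ ∘ₗ ρ)) = χ (ρ φ) := fun χ φ =>
    LinearMap.congr_fun (δ.apply_symm_apply (χ ∘ₗ ρ)) φ
  have hrange : LinearMap.range G = LinearMap.ker (deltaMap R ω M) := by
    ext m
    constructor
    · rintro ⟨χ, rfl⟩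
      refine LinearMap.ext fun ψ => (hδ χ (ψ ∘ₗ g)).trans ?_
      have : ρ (ψ ∘ₗ g) = 0 := Subtype.ext (LinearMap.ext fun q => by
        change ψ (g (f q)) = 0
        rw [hfg.apply_apply_eq_zero, map_zero])
      rw [this, map_zero]
      rfl
    · intro hm
      obtain ⟨p, rfl⟩ := hg m
      obtain ⟨χ, hχ⟩ := LinearMap.exists_comp_eq_of_ker_le_ker hρ (φ := δ p) fun φ hφ => by
        obtain ⟨ψ, rfl⟩ := LinearMap.exists_comp_eq_of_ker_le_ker hg (φ := φ) fun p hp => by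
          obtain ⟨q, rfl⟩ := (hfg p).mp hp
          exact LinearMap.congr_fun (congrArg Subtype.val hφ) q
        exact LinearMap.congr_fun hm ψ
      exact ⟨χ, congrArg g ((LinearEquiv.symm_apply_eq δ).mpr hχ)⟩
  have hkerG : LinearMap.ker G = LinearMap.ker E := by
    ext χ
    rw [LinearMap.mem_ker, LinearMap.mem_ker, hker]
    constructor
    · intro hχ
      obtain ⟨q, hq⟩ := (hfg _).mp hχ
      refine ⟨deltaMap R ω P₁ q, LinearMap.ext fun x => ?_⟩
      obtain ⟨φ, rfl⟩ := hρ x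
      exact (congrArg φ hq).trans (hδ χ φ)
    · rintro ⟨Φ, rfl⟩
      obtain ⟨q, rfl⟩ := h₁ Φ
      refine (hfg _).mpr ⟨q, ?_⟩
      exact ((LinearEquiv.symm_apply_eq δ).mpr rfl).symm
  exact ⟨(LinearEquiv.ofEq _ _ hrange).symm ≪≫ₗ G.quotKerEquivRange.symm ≪≫ₗ
    Submodule.quotEquivOfEq _ _ hkerG ≪≫ₗ E.quotKerEquivOfSurjective hE⟩

end

/-- for a projective presentation `P₁ →f P₀ → M → 0` and the ω-transpose
`tr_ω M = coker (f† : P₀† → P₁†)`, one has `ker δ_M ≅ Ext^1(tr_ω M, ω)`. -/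
theorem ker_delta_iso_ext_one_transpose (R : Type) [CommRing R] [IsNoetherianRing R]
    [IsLocalRing R]
    (d : ℕ) (hdim : ringKrullDim R = d) (hCM : (d : ℕ∞) ≤ rdepth R R)
    (ω : Type) [AddCommGroup ω] [Module R ω] (hω : IsCanonicalModule R d ω)
    (M P0 P1 : Type) [AddCommGroup M] [Module R M] [AddCommGroup P0] [Module R P0]
    [AddCommGroup P1] [Module R P1]
    [Module.Finite R M] [Module.Finite R P0] [Module.Finite R P1]
    [Module.Projective R P0] [Module.Projective R P1]
    (f : P1 →ₗ[R] P0) (g : P0 →ₗ[R] M)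
    (hfg : Function.Exact f g) (hg : Function.Surjective g) :
    Nonempty (↥(LinearMap.ker (deltaMap R ω M)) ≃ₗ[R]
      ↥(ext1 R 1 ((P1 →ₗ[R] ω) ⧸ LinearMap.range (dmap R ω f)) ω)) := by
  have := Module.free_of_flat_of_isLocalRing (R := R) (P := P0)
  have := Module.free_of_flat_of_isLocalRing (R := R) (P := P1)
  have b₀ := Module.Free.chooseBasis R P0
  have b₁ := Module.Free.chooseBasis R P1
  obtain ⟨hend, hann⟩ := hω.exists_smul_and_annihilator_eq_bot hdim hCM
  have := hω.subsingleton_ext_self hdim hCM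
  have := subsingleton_ext_dual (ω := ω) b₁ (ModuleCat.of R ω) 1
  obtain ⟨e⟩ := nonempty_ker_deltaMap_linearEquiv_ext (ω := ω) hfg hg
    (deltaMap_bijective b₀ hend hann) (deltaMap_bijective b₁ hend hann).2
  obtain ⟨e'⟩ := nonempty_ext1_linearEquiv (R := R) 1
    ((P1 →ₗ[R] ω) ⧸ LinearMap.range (dmap R ω f)) ω
  exact ⟨e.trans e'.symm⟩
end

section
/- For a finitely generated R-module M, one has Ext^1_R(Z, M) = 0 for every maximal Cohen–Macaulay R-module Z if and only if M has finite injective dimension over R. -/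
open CategoryTheory

open CategoryTheory Abelian IsLocalRing RingTheory.Sequence

section ExtComparison

variable {A : Type} [CommRing A]

theorem CategoryTheory.ProjectiveResolution.subsingleton_ext_zero_iff {X Y : ModuleCat.{0} A}
    (P : ProjectiveResolution X) :
    Subsingleton (Abelian.Ext X Y 0) ↔
      ∀ f : P.complex.X 0 ⟶ Y, P.complex.d 1 0 ≫ f = 0 → f = 0 := by
  rw [Ext.homEquiv₀.subsingleton_congr]
  constructor
  · intro h f hf
    have := P.exact₀.g_desc (k := f) hf
    rw [← this]
    have h0 : P.exact₀.desc f hf = 0 := h.elim _ _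
    rw [h0, Limits.comp_zero]
  · intro h
    let π : P.complex.X 0 ⟶ X := P.π.f 0
    have : Epi π := inferInstanceAs (Epi (P.π.f 0))
    have hπ : P.complex.d 1 0 ≫ π = 0 := P.complex_d_comp_π_f_zero
    refine subsingleton_of_forall_eq 0 fun a ↦ ?_
    rw [← cancel_epi π, Limits.comp_zero]
    exact h (π ≫ a) (by rw [← Category.assoc, hπ, Limits.zero_comp])

theorem CategoryTheory.ProjectiveResolution.subsingleton_ext_succ_iff {X Y : ModuleCat.{0} A}
    (P : ProjectiveResolution X) (n : ℕ) :
    Subsingleton (Abelian.Ext X Y (n + 1)) ↔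
      ∀ f : P.complex.X (n + 1) ⟶ Y, P.complex.d (n + 2) (n + 1) ≫ f = 0 →
        ∃ g : P.complex.X n ⟶ Y, P.complex.d (n + 1) n ≫ g = f := by
  constructor
  · intro h f hf
    exact (P.extMk_eq_zero_iff f (n + 2) rfl hf n rfl).1 (h.elim _ _)
  · intro h
    refine subsingleton_of_forall_eq 0 fun e ↦ ?_
    obtain ⟨f, hf, rfl⟩ := P.extMk_surjective e (n + 2) rfl
    exact (P.extMk_eq_zero_iff f (n + 2) rfl hf n rfl).2 (h f hf)

theorem subsingleton_ext1_iff (n : ℕ) (M N : Type) [AddCommGroup M] [Module A M]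
    [AddCommGroup N] [Module A N] :
    Subsingleton (ext1 A n M N) ↔
      Subsingleton (Abelian.Ext (ModuleCat.of A M) (ModuleCat.of A N) n) := by
  let P := projectiveResolution (ModuleCat.of A M)
  rw [ext1, (P.isoExt (R := A) n (ModuleCat.of A N)).toLinearEquiv.toEquiv.subsingleton_congr,
    ← ModuleCat.isZero_iff_subsingleton, ← HomologicalComplex.exactAt_iff_isZero_homology]
  cases n with
  | zero =>
    rw [P.subsingleton_ext_zero_iff,
      HomologicalComplex.exactAt_iff' _ 0 0 1 (by simp) (by simp),
      ShortComplex.moduleCat_exact_iff]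
    refine forall_congr' fun f ↦ imp_congr_right fun _ ↦ ⟨?_, ?_⟩
    · rintro ⟨g, hg⟩
      rw [← hg]
      exact (congrArg (· ≫ g) (P.complex.shape 0 0 (by simp))).trans Limits.zero_comp
    · intro hf
      exact ⟨0, (map_zero _).trans hf.symm⟩
  | succ n =>
    rw [P.subsingleton_ext_succ_iff,
      HomologicalComplex.exactAt_iff' _ n (n + 1) (n + 2) (by simp) (by simp),
      ShortComplex.moduleCat_exact_iff]
    exact Iff.rfl

end ExtComparison

section Local

variable {R : Type} [CommRing R]

theorem natCast_le_rdepth_iff [IsLocalRing R] (d : ℕ) (M : Type) [AddCommGroup M] [Module R M] :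
    (d : ℕ∞) ≤ rdepth R M ↔ ∀ i < d,
      Subsingleton (Ext (ModuleCat.of R (ResidueField R)) (ModuleCat.of R M) i) := by
  simp only [rdepth, le_sInf_iff, Set.mem_ofPred_eq, subsingleton_ext1_iff]
  constructor
  · intro h i hi
    by_contra hs
    exact absurd (h i ⟨i, rfl, hs⟩) (by simpa using hi)
  · rintro h _ ⟨m, rfl, hm⟩
    by_contra hlt
    exact hm (h m (by simpa using hlt))

/-- Vanishing of `Ext^(n+1)(A/I, -)` for all ideals `I` bounds the injective dimension. -/
theorem ModuleCat.hasInjectiveDimensionLE_of_forall_ideal (n : ℕ) (M : ModuleCat.{0} R)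
    (h : ∀ I : Ideal R, Subsingleton (Ext (ModuleCat.of R (R ⧸ I)) M (n + 1))) :
    HasInjectiveDimensionLE M n := by
  induction n generalizing M with
  | zero =>
    rw [HasInjectiveDimensionLE, zero_add, ← injective_iff_hasInjectiveDimensionLT_one,
      ← Module.injective_iff_injective_object R M, ← Module.Baer.iff_injective]
    intro I g
    have hS := LinearMap.shortExact_shortComplexKer (Submodule.mkQ_surjective I)
    let e : ↥(LinearMap.ker I.mkQ) →ₗ[R] I := Submodule.inclusion (Submodule.ker_mkQ I).le
    have hI := h I
    obtain ⟨φ, hφ⟩ := Ext.contravariant_sequence_exact₁ hS M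
      (Ext.mk₀ (ModuleCat.ofHom (g ∘ₗ e))) (add_comm 1 0) (hI.elim _ _)
    obtain ⟨φ, rfl⟩ := Ext.homEquiv₀.symm.surjective φ
    rw [Ext.homEquiv₀_symm_apply, Ext.mk₀_comp_mk₀] at hφ
    have hφ' := Ext.homEquiv₀.symm.injective hφ
    refine ⟨φ.hom, fun x hx ↦ ?_⟩
    exact LinearMap.congr_fun (congrArg ModuleCat.Hom.hom hφ') ⟨x, by simpa using hx⟩
  | succ n ih =>
    let ⟨I, _, f, _⟩ := EnoughInjectives.presentation M
    have hS : (ShortComplex.mk _ _ (Limits.cokernel.condition f)).ShortExact :=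
      { exact := ShortComplex.exact_cokernel f }
    refine (hS.hasInjectiveDimensionLT_X₃_iff n inferInstance).1 (ih _ fun J ↦ ?_)
    refine subsingleton_of_forall_eq 0 fun x ↦ ?_
    obtain ⟨y, rfl⟩ := Ext.covariant_sequence_exact₃ _ hS x rfl ((h J).elim _ _)
    rw [Ext.eq_zero_of_injective y, Ext.zero_comp]

variable [IsNoetherianRing R] [IsLocalRing R]

open scoped Pointwise in
theorem subsingleton_ext_of_isSMulRegular (N M : ModuleCat.{0} R) [Module.Finite R N]
    [Module.Finite R M] {x : R} (hx : x ∈ maximalIdeal R) (reg : IsSMulRegular N x) (i : ℕ)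
    (h : Subsingleton (Ext (ModuleCat.of R (QuotSMulTop x N)) M (i + 1))) :
    Subsingleton (Ext N M i) := by
  have hS := reg.smulShortComplex_shortExact
  by_contra hn
  rw [not_subsingleton_iff_nontrivial] at hn
  have hmem : x ∈ (Module.annihilator R (Ext N M i)).jacobson :=
    maximalIdeal_le_jacobson _ hx
  refine Submodule.top_ne_pointwise_smul_of_mem_jacobson_annihilator hmem
    (eq_top_iff.2 fun y _ ↦ ?_).symm
  obtain ⟨z, rfl⟩ := Ext.contravariant_sequence_exact₁ hS M y (add_comm 1 i) (h.elim _ _)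
  have hz (z : Ext N M i) : (Ext.mk₀ (x • 𝟙 N)).comp z (zero_add i) = x • z := by
    rw [Ext.mk₀_smul, Ext.smul_comp, Ext.mk₀_id_comp]
  have hzmem (z : Ext N M i) : x • z ∈ x • (⊤ : Submodule R (Ext N M i)) :=
    Submodule.smul_mem_pointwise_smul z x ⊤ trivial
  exact hz z ▸ hzmem z

theorem subsingleton_ext_of_isWeaklyRegular_s16 (M : ModuleCat.{0} R) [Module.Finite R M] (d : ℕ)
    (hM : ∀ (N : ModuleCat.{0} R) [Module.Finite R N] (i : ℕ), d < i → Subsingleton (Ext N M i))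
    (Z : ModuleCat.{0} R) [Module.Finite R Z] (rs : List R) (hrs : ∀ r ∈ rs, r ∈ maximalIdeal R)
    (reg : IsWeaklyRegular Z rs) (i : ℕ) (hi : d < i + rs.length) :
    Subsingleton (Ext Z M i) := by
  induction rs generalizing Z i with
  | nil => exact hM Z i (by simpa using hi)
  | cons x rs ih =>
    rw [isWeaklyRegular_cons_iff] at reg
    refine subsingleton_ext_of_isSMulRegular Z M (hrs x (by simp)) reg.1 i ?_
    exact ih (ModuleCat.of R (QuotSMulTop x Z)) (fun r hr ↦ hrs r (by simp [hr])) reg.2 (i + 1)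
      (by simp only [List.length_cons] at hi; omega)

omit [IsNoetherianRing R] in
theorem maximalIdeal_smul_top_lt (Z : Type) [AddCommGroup Z] [Module R Z] [Module.Finite R Z]
    [Nontrivial Z] : maximalIdeal R • (⊤ : Submodule R Z) < ⊤ :=
  lt_top_iff_ne_top.2 (Submodule.top_ne_ideal_smul_of_le_jacobson_annihilator
    (maximalIdeal_le_jacobson _)).symm

theorem exists_isRegular_of_le_rdepth (d : ℕ) (Z : Type) [AddCommGroup Z] [Module R Z]
    [Module.Finite R Z] [Nontrivial Z] (h : (d : ℕ∞) ≤ rdepth R Z) :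
    ∃ rs : List R, rs.length = d ∧ (∀ r ∈ rs, r ∈ maximalIdeal R) ∧ IsRegular Z rs := by
  rw [natCast_le_rdepth_iff] at h
  have : Module.Finite R (ModuleCat.of R (ResidueField R)) :=
    inferInstanceAs (Module.Finite R (R ⧸ maximalIdeal R))
  refine ModuleCat.exists_isRegular_of_exists_subsingleton_ext (maximalIdeal R) d
    (ModuleCat.of R Z) (maximalIdeal_smul_top_lt Z) (ModuleCat.of R (ResidueField R)) ?_ h
  exact (Module.support_eq_zeroLocus (R := R) (M := R ⧸ maximalIdeal R)).trans
    (by rw [Ideal.annihilator_quotient])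

/-- In a Cohen-Macaulay local ring the residue field embeds into a finitely generated module of
projective dimension equal to the dimension of the ring. -/
theorem exists_residueField_embedding (d : ℕ) (hdim : ringKrullDim R = d)
    (hCM : (d : ℕ∞) ≤ rdepth R R) :
    ∃ Q : ModuleCat.{0} R, Module.Finite R Q ∧ HasProjectiveDimensionLT Q (d + 1) ∧
      ∃ f : (R ⧸ maximalIdeal R) →ₗ[R] Q, Function.Injective f := by
  obtain ⟨rs, hlen, hmem, hreg⟩ := exists_isRegular_of_le_rdepth d R hCM
  have hpd := ModuleCat.projectiveDimension_quotient_eq_add_length_of_isWeaklyRegular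
    (ModuleCat.of R R) rs hreg.1 hmem
  rw [ModuleCat.projectiveDimension_eq_zero_of_projective (ModuleCat.of R R), zero_add,
    hlen] at hpd
  refine ⟨ModuleCat.of R (R ⧸ Ideal.ofList rs • (⊤ : Submodule R R)), inferInstance,
    (projectiveDimension_le_iff _ d).1 hpd.le, ?_⟩
  have : Nontrivial (R ⧸ Ideal.ofList rs • (⊤ : Submodule R R)) :=
    Submodule.Quotient.nontrivial_iff.2 hreg.2.symm
  obtain ⟨p, hp⟩ := associatedPrimes.nonempty R (R ⧸ Ideal.ofList rs • (⊤ : Submodule R R))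
  obtain ⟨hp, x, hx⟩ := Submodule.isAssociatedPrime_iff.1 hp
  have hmem (r : R) : r ∈ p ↔ r • x = 0 := by
    rw [hx, Submodule.mem_colon_singleton, Submodule.mem_bot]
  have hIp : Ideal.ofList rs ≤ p := fun r hr ↦ (hmem r).2 <| by
    obtain ⟨y, rfl⟩ := Submodule.Quotient.mk_surjective _ x
    rw [← Submodule.Quotient.mk_smul, Submodule.Quotient.mk_eq_zero]
    exact Submodule.smul_mem_smul hr trivial
  have hdim₀ : ringKrullDim (R ⧸ Ideal.ofList rs) ≤ 0 := by
    have := ringKrullDim_add_length_eq_ringKrullDim_of_isRegular rs hreg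
    rw [hlen, hdim] at this
    generalize ringKrullDim (R ⧸ Ideal.ofList rs) = a at this
    induction a with
    | bot => simp
    | coe a =>
      induction a with
      | top =>
        have : (⊤ : ℕ∞) + d = d := WithBot.coe_injective this
        simp at this
      | coe a => norm_cast at this ⊢; omega
  have : Ring.KrullDimLE 0 (R ⧸ Ideal.ofList rs) := Ring.krullDimLE_iff.2 hdim₀
  have hpmax : p = maximalIdeal R := by
    have := Ideal.map_isPrime_of_surjective (f := Ideal.Quotient.mk (Ideal.ofList rs))
      Ideal.Quotient.mk_surjective (I := p) (by rwa [Ideal.mk_ker])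
    have := Ideal.IsPrime.isMaximal' (I := p.map (Ideal.Quotient.mk (Ideal.ofList rs)))
    have := Ideal.comap_isMaximal_of_surjective (Ideal.Quotient.mk (Ideal.ofList rs))
      Ideal.Quotient.mk_surjective (K := p.map (Ideal.Quotient.mk (Ideal.ofList rs)))
    rw [Ideal.comap_map_of_surjective' _ Ideal.Quotient.mk_surjective, Ideal.mk_ker,
      sup_eq_left.2 hIp] at this
    exact eq_maximalIdeal this
  subst hpmax
  refine ⟨(maximalIdeal R).liftQ (LinearMap.toSpanSingleton R _ x) fun r hr ↦ (hmem r).1 hr,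
    LinearMap.ker_eq_bot.1 (Submodule.ker_liftQ_eq_bot _ _ _ fun r hr ↦ (hmem r).2 hr)⟩

omit [IsNoetherianRing R] [IsLocalRing R] in
/-- `Ext^i(N, -)` vanishes on finite powers of a module on which it vanishes. -/
theorem subsingleton_ext_pi (N : ModuleCat.{0} R) (M : Type) [AddCommGroup M] [Module R M]
    (i n : ℕ) (h : Subsingleton (Ext N (ModuleCat.of R M) i)) :
    Subsingleton (Ext N (ModuleCat.of R (Fin n → M)) i) := by
  refine subsingleton_of_forall_eq 0 fun x ↦ ?_
  have hid : 𝟙 (ModuleCat.of R (Fin n → M)) = ∑ j, ModuleCat.ofHom (LinearMap.proj j) ≫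
      ModuleCat.ofHom (LinearMap.single R (fun _ ↦ M) j) := by
    ext1
    rw [ModuleCat.hom_sum]
    refine LinearMap.ext fun v ↦ ?_
    simpa using (Finset.univ_sum_single v).symm
  rw [← x.comp_mk₀_id, hid, Ext.mk₀_sum, Ext.comp_sum]
  refine Finset.sum_eq_zero fun j _ ↦ ?_
  rw [← Ext.mk₀_comp_mk₀, ← Ext.comp_assoc_of_second_deg_zero,
    h.elim (x.comp (Ext.mk₀ (ModuleCat.ofHom (LinearMap.proj j))) (add_zero i)) 0, Ext.zero_comp]

theorem subsingleton_ext_of_dim_lt (d : ℕ) (hdim : ringKrullDim R = d)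
    (hCM : (d : ℕ∞) ≤ rdepth R R) (M : ModuleCat.{0} R) [Module.Finite R M] (n : ℕ)
    (hM : ∀ (N : ModuleCat.{0} R) (i : ℕ), n < i → Subsingleton (Ext N M i))
    (N : ModuleCat.{0} R) [Module.Finite R N] (i : ℕ) (hi : d < i) :
    Subsingleton (Ext N M i) := by
  obtain ⟨Q, _, hQ, f, hf⟩ := exists_residueField_embedding d hdim hCM
  suffices H : ∀ (k : ℕ) (i : ℕ), d < i → n < i + k → ∀ (N : Type) [AddCommGroup N] [Module R N]
      [Module.Finite R N], Subsingleton (Ext (ModuleCat.of R N) M i) from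
    H (n + 1) i hi (by omega) N
  intro k
  induction k with
  | zero => intro i _ hni N _ _ _; exact hM _ i hni
  | succ k ih =>
    intro i hi hni N _ _ hN
    induction hN using IsNoetherianRing.induction_on_isQuotientEquivQuotientPrime R with
    | subsingleton N =>
      have hz : Limits.IsZero (ModuleCat.of R N) := ModuleCat.isZero_of_subsingleton _
      exact HasProjectiveDimensionLT.subsingleton _ 0 (hX := hz.hasProjectiveDimensionLT_zero) i
        (Nat.zero_le _) M
    | quotient N p e =>
      by_cases hp : p.1 = maximalIdeal R
      · let g : N →ₗ[R] Q := f ∘ₗ (Submodule.quotEquivOfEq _ _ hp).toLinearMap ∘ₗ e.toLinearMap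
        have hg : Function.Injective g := by
          simpa [g] using hf
        have hS := ModuleCat.shortComplex_shortExact
          (ModuleCat.shortComplexOfCompEqZero _ _ g.exact_map_mkQ_range.linearMap_comp_eq_zero)
          g.exact_map_mkQ_range hg (Submodule.mkQ_surjective _)
        refine subsingleton_of_forall_eq 0 fun x ↦ ?_
        obtain ⟨y, rfl⟩ := Ext.contravariant_sequence_exact₁ hS M x (add_comm 1 i)
          ((ih (i + 1) (by omega) (by omega) _).elim _ _)
        rw [y.eq_zero_of_hasProjectiveDimensionLT (d + 1) hi, Ext.comp_zero]
      · obtain ⟨x, hx, hxp⟩ := SetLike.exists_of_lt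
          (lt_of_le_of_ne (le_maximalIdeal p.2.ne_top) hp)
        have reg : IsSMulRegular N x := by
          rw [e.isSMulRegular_congr x, isSMulRegular_iff_right_eq_zero_of_smul]
          intro y hy
          obtain ⟨y, rfl⟩ := Ideal.Quotient.mk_surjective y
          rw [← Ideal.Quotient.mk_eq_mk, ← Submodule.Quotient.mk_smul, Ideal.Quotient.mk_eq_mk,
            Ideal.Quotient.eq_zero_iff_mem] at hy
          exact Ideal.Quotient.eq_zero_iff_mem.2 ((p.2.mem_or_mem hy).resolve_left hxp)
        exact subsingleton_ext_of_isSMulRegular (ModuleCat.of R N) M hx reg i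
          (ih (i + 1) (by omega) (by omega) _)
    | exact N₁ N₂ N₃ f g hf hg hfg h₁ h₃ =>
      have hS := ModuleCat.shortComplex_shortExact
        (ModuleCat.shortComplexOfCompEqZero f g hfg.linearMap_comp_eq_zero) hfg hf hg
      refine subsingleton_of_forall_eq 0 fun x ↦ ?_
      obtain ⟨y, rfl⟩ := Ext.contravariant_sequence_exact₂ hS M x (h₁.elim _ _)
      rw [h₃.elim y 0, Ext.comp_zero]

/-- If `Ext^1(Z, M) = 0` for all maximal Cohen-Macaulay `Z`, then by passing to syzygies
`Ext^(t+1)(N, M) = 0` whenever `depth N + t ≥ dim A`. -/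
theorem subsingleton_ext_of_forall_isMCM (d : ℕ) (hCM : (d : ℕ∞) ≤ rdepth R R) (M : Type)
    [AddCommGroup M] [Module R M]
    (h : ∀ (Z : Type) [AddCommGroup Z] [Module R Z], IsMCM R d Z → Subsingleton (ext1 R 1 Z M))
    (t : ℕ) (N : Type) [AddCommGroup N] [Module R N] [Module.Finite R N]
    (hN : ∀ i, i + t < d →
      Subsingleton (Ext (ModuleCat.of R (ResidueField R)) (ModuleCat.of R N) i)) :
    Subsingleton (Ext (ModuleCat.of R N) (ModuleCat.of R M) (t + 1)) := by
  induction t generalizing N with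
  | zero =>
    rw [← subsingleton_ext1_iff]
    exact h N ⟨inferInstance, (natCast_le_rdepth_iff d N).2 hN⟩
  | succ t ih =>
    obtain ⟨n, f, hf⟩ := Module.Finite.exists_fin' R N
    have hS := LinearMap.shortExact_shortComplexKer hf
    have hK : Subsingleton (Ext (ModuleCat.of R (LinearMap.ker f)) (ModuleCat.of R M) (t + 1)) := by
      refine ih _ fun i hi ↦ subsingleton_of_forall_eq 0 fun x ↦ ?_
      have hF : Subsingleton
          (Ext (ModuleCat.of R (ResidueField R)) (ModuleCat.of R (Fin n → R)) i) :=
        subsingleton_ext_pi _ R i n ((natCast_le_rdepth_iff d R).1 hCM i (by omega))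
      cases i with
      | zero =>
        have := hS.mono_f
        exact Ext.postcomp_mk₀_injective_of_mono _ (LinearMap.shortComplexKer f).f (hF.elim _ _)
      | succ i =>
        obtain ⟨y, rfl⟩ := Ext.covariant_sequence_exact₁ _ hS x (hF.elim _ _) rfl
        rw [(hN i (by omega)).elim y 0, Ext.zero_comp]
    have : Projective (ModuleCat.of R (Fin n → R)) := inferInstance
    refine subsingleton_of_forall_eq 0 fun x ↦ ?_
    obtain ⟨y, rfl⟩ := Ext.contravariant_sequence_exact₃ hS (ModuleCat.of R M) x
      (Ext.eq_zero_of_projective _) (add_comm 1 (t + 1))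
    rw [hK.elim y 0, Ext.comp_zero]

end Local

/-- `Ext^1(Z, M) = 0` for every maximal Cohen-Macaulay `Z` iff `M` has
finite injective dimension. -/
theorem ext_vanishing_iff_finite_injective_dimension (R : Type) [CommRing R]
    [IsNoetherianRing R] [IsLocalRing R]
    (d : ℕ) (hdim : ringKrullDim R = d) (hCM : (d : ℕ∞) ≤ rdepth R R)
    (ω : Type) [AddCommGroup ω] [Module R ω] (hω : IsCanonicalModule R d ω)
    (M : Type) [AddCommGroup M] [Module R M] [Module.Finite R M] :
    (∀ (Z : Type) [AddCommGroup Z] [Module R Z], IsMCM R d Z →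
        Subsingleton (ext1 R 1 Z M)) ↔ HasFID R M := by
  constructor
  · intro h
    have hid : HasInjectiveDimensionLE (ModuleCat.of R M) d :=
      ModuleCat.hasInjectiveDimensionLE_of_forall_ideal d _ fun I ↦
        subsingleton_ext_of_forall_isMCM d hCM M h d (R ⧸ I) fun i hi ↦ by omega
    refine ⟨d, fun N _ _ m hm ↦ ?_⟩
    rw [subsingleton_ext1_iff]
    exact HasInjectiveDimensionLT.subsingleton (ModuleCat.of R M) (d + 1) m hm _
  · rintro ⟨n, hn⟩ Z _ _ ⟨_, hZ⟩
    rw [subsingleton_ext1_iff]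
    have hM (N : ModuleCat.{0} R) [Module.Finite R N] (i : ℕ) (hi : d < i) :
        Subsingleton (Ext N (ModuleCat.of R M) i) :=
      subsingleton_ext_of_dim_lt d hdim hCM (ModuleCat.of R M) n
        (fun N i hi ↦ (subsingleton_ext1_iff i N M).1 (hn N i hi)) N i hi
    cases subsingleton_or_nontrivial Z
    · have hz : Limits.IsZero (ModuleCat.of R Z) := ModuleCat.isZero_of_subsingleton _
      exact HasProjectiveDimensionLT.subsingleton _ 0 (hX := hz.hasProjectiveDimensionLT_zero) 1
        (Nat.zero_le _) _
    · obtain ⟨rs, hlen, hmem, hreg⟩ := exists_isRegular_of_le_rdepth d Z hZ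
      exact subsingleton_ext_of_isWeaklyRegular_s16 (ModuleCat.of R M) d hM (ModuleCat.of R Z) rs hmem
        hreg.1 1 (by omega)
end

section
/- Suppose R is Henselian. Let M be a finitely generated R-module and let 0 → M → X⁰ → X¹ → ⋯ and 0 → M → X'⁰ → X'¹ → ⋯ be two special proper CM-coresolutions of M, with induced maps μ^i : coker d^{i−1} → X^i and μ'^i : coker d'^{i−1} → X'^i. Then for each i, coker μ^i and coker μ'^i agree up to free direct summands: there exist finitely generated free R-modules F and F' with coker μ^i ⊕ F ≅ coker μ'^i ⊕ F'. -/
open CategoryTheory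

noncomputable section Coresolution

variable (R : Type) [CommRing R] [IsLocalRing R]
  (M : Type) [AddCommGroup M] [Module R M]
  (X : ℕ → ModuleCat.{0} R)
  (d0 : M →ₗ[R] ↥(X 0)) (dn : ∀ i, ↥(X i) →ₗ[R] ↥(X (i+1)))

/-- `coker d^{i-1}`, the source of the induced map `μ^i` (for `i = 0` it is `M`). -/
def cokerAt : ℕ → Type
  | 0 => M
  | 1 => ↥(X 0) ⧸ LinearMap.range d0
  | (i+2) => ↥(X (i+1)) ⧸ LinearMap.range (dn i)

instance cokerAtAddCommGroup : ∀ i, AddCommGroup (cokerAt R M X d0 dn i)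
  | 0 => inferInstanceAs (AddCommGroup M)
  | 1 => inferInstanceAs (AddCommGroup (↥(X 0) ⧸ LinearMap.range d0))
  | (i+2) => inferInstanceAs (AddCommGroup (↥(X (i+1)) ⧸ LinearMap.range (dn i)))

instance cokerAtModule : ∀ i, Module R (cokerAt R M X d0 dn i)
  | 0 => inferInstanceAs (Module R M)
  | 1 => inferInstanceAs (Module R (↥(X 0) ⧸ LinearMap.range d0))
  | (i+2) => inferInstanceAs (Module R (↥(X (i+1)) ⧸ LinearMap.range (dn i)))

variable (hc0 : LinearMap.range d0 ≤ LinearMap.ker (dn 0))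
  (hc : ∀ i, LinearMap.range (dn i) ≤ LinearMap.ker (dn (i+1)))

/-- The induced map `μ^i : coker d^{i-1} → X^i`. -/
def muAt : ∀ i, cokerAt R M X d0 dn i →ₗ[R] ↥(X i)
  | 0 => d0
  | 1 => Submodule.liftQ _ (dn 0) hc0
  | (i+2) => Submodule.liftQ _ (dn (i+1)) (hc i)

/-- The complex `0 → M → X⁰ → X¹ → ⋯` of maximal Cohen-Macaulay modules is a special
proper CM-coresolution of `M` if every induced map `μ^i` is a special CM-preenvelope. -/
def IsSpecialProperCMCoresolution (d : ℕ) : Prop :=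
  (∀ i, IsMCM R d ↥(X i)) ∧ ∀ i, IsSpecialCMPreenvelope R d (muAt R M X d0 dn hc0 hc i)

/-- The complex `0 → M → X⁰ → X¹ → ⋯` of maximal Cohen-Macaulay modules is a minimal
proper CM-coresolution of `M` if every induced map `μ^i` is a CM-envelope. -/
def IsMinimalProperCMCoresolution (d : ℕ) : Prop :=
  (∀ i, IsMCM R d ↥(X i)) ∧ ∀ i, IsCMEnvelope R d (muAt R M X d0 dn hc0 hc i)

end Coresolution

section ExtVanishing

variable {A : Type} [CommRing A]

/-- Vanishing of `Ext` in terms of cocycles on a projective resolution. In degree `0` the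
differential `d 0 0` is zero. -/
theorem subsingleton_ext1_iff_s17 {M : Type} [AddCommGroup M] [Module A M]
    (P : ProjectiveResolution (ModuleCat.of A M)) (n : ℕ)
    (Y : Type) [AddCommGroup Y] [Module A Y] :
    Subsingleton (ext1 A n M Y) ↔
      ∀ f : P.complex.X n ⟶ ModuleCat.of A Y, P.complex.d (n + 1) n ≫ f = 0 →
        ∃ g : P.complex.X (n - 1) ⟶ ModuleCat.of A Y, P.complex.d n (n - 1) ≫ g = f := by
  have hprev : (ComplexShape.up ℕ).prev n = n - 1 := by
    cases n <;> simp
  rw [← ModuleCat.isZero_iff_subsingleton]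
  unfold ext1
  rw [(P.isoExt n (ModuleCat.of A Y)).isZero_iff,
    ← HomologicalComplex.exactAt_iff_isZero_homology,
    HomologicalComplex.exactAt_iff' _ (n - 1) n (n + 1) hprev (by simp),
    ShortComplex.moduleCat_exact_iff]
  rfl

theorem ext1_ker_subsingleton {M : Type} [AddCommGroup M] [Module A M]
    {F X : Type} [AddCommGroup F] [Module A F] [AddCommGroup X] [Module A X]
    (p : F →ₗ[A] X) (hp : Function.Surjective p) (n : ℕ)
    (hF : Subsingleton (ext1 A n M F))
    (hX : ∀ m, m + 1 = n → Subsingleton (ext1 A m M X)) :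
    Subsingleton (ext1 A n M (LinearMap.ker p)) := by
  obtain ⟨P⟩ : Nonempty (ProjectiveResolution (ModuleCat.of A M)) :=
    HasProjectiveResolution.out
  rw [subsingleton_ext1_iff_s17 P] at hF ⊢
  intro f hf
  let ι : ModuleCat.of A (LinearMap.ker p) ⟶ ModuleCat.of A F :=
    ModuleCat.ofHom (LinearMap.ker p).subtype
  let q : ModuleCat.of A F ⟶ ModuleCat.of A X := ModuleCat.ofHom p
  have hιq : ι ≫ q = 0 := by
    ext x
    exact x.2
  have : Epi q := (ModuleCat.epi_iff_surjective _).2 hp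
  have : Mono ι := (ModuleCat.mono_iff_injective _).2 (Submodule.injective_subtype _)
  obtain ⟨g, hg⟩ := hF (f ≫ ι) (by rw [reassoc_of% hf, Limits.zero_comp])
  rcases n with _ | m
  · refine ⟨0, ?_⟩
    rw [← cancel_mono ι, ← hg]
    simp
  · have hX := hX m rfl
    rw [subsingleton_ext1_iff_s17 P] at hX
    obtain ⟨h, hh⟩ := hX (g ≫ q) (by
      have := congrArg (· ≫ q) hg
      simpa [hιq] using this)
    change P.complex.X m ⟶ ModuleCat.of A F at g
    change P.complex.d (m + 1) m ≫ g = f ≫ ι at hg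
    let h' := Projective.factorThru h q
    have hh' : h' ≫ q = h := Projective.factorThru_comp h q
    let g₀ : P.complex.X m ⟶ ModuleCat.of A F := g - P.complex.d m (m - 1) ≫ h'
    have hg₀ : g₀ ≫ q = 0 := by simp [g₀, hh', hh]
    let g' : P.complex.X m ⟶ ModuleCat.of A (LinearMap.ker p) :=
      ModuleCat.ofHom (LinearMap.codRestrict _ g₀.hom
        (fun x => ConcreteCategory.congr_hom hg₀ x))
    have hg' : g' ≫ ι = g₀ := by
      ext x
      rfl
    refine ⟨g', ?_⟩
    rw [← cancel_mono ι, Category.assoc]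
    change P.complex.d (m + 1) m ≫ g' ≫ ι = _
    rw [hg', ← hg]
    simp [g₀]

theorem exists_lift_of_ext1_ker_subsingleton {C : Type} [AddCommGroup C] [Module A C]
    {F X : Type} [AddCommGroup F] [Module A F] [AddCommGroup X] [Module A X]
    (p : F →ₗ[A] X) (hp : Function.Surjective p)
    (hK : Subsingleton (ext1 A 1 C (LinearMap.ker p))) (φ : C →ₗ[A] X) :
    ∃ ψ : C →ₗ[A] F, p ∘ₗ ψ = φ := by
  obtain ⟨P⟩ : Nonempty (ProjectiveResolution (ModuleCat.of A C)) :=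
    HasProjectiveResolution.out
  rw [subsingleton_ext1_iff_s17 P] at hK
  let ι : ModuleCat.of A (LinearMap.ker p) ⟶ ModuleCat.of A F :=
    ModuleCat.ofHom (LinearMap.ker p).subtype
  let q : ModuleCat.of A F ⟶ ModuleCat.of A X := ModuleCat.ofHom p
  have hιq : ι ≫ q = 0 := by
    ext x
    exact x.2
  have : Epi q := (ModuleCat.epi_iff_surjective _).2 hp
  have : Mono ι := (ModuleCat.mono_iff_injective _).2 (Submodule.injective_subtype _)
  let ε : P.complex.X 0 ⟶ ModuleCat.of A C := P.π.f 0
  have hε : P.complex.d 1 0 ≫ ε = 0 := P.complex_d_comp_π_f_zero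
  let ψ₀ : P.complex.X 0 ⟶ ModuleCat.of A F :=
    Projective.factorThru (ε ≫ ModuleCat.ofHom φ) q
  have hψ₀ : ψ₀ ≫ q = ε ≫ ModuleCat.ofHom φ := Projective.factorThru_comp _ q
  have hd : (P.complex.d 1 0 ≫ ψ₀) ≫ q = 0 := by
    rw [Category.assoc, hψ₀, reassoc_of% hε, Limits.zero_comp]
  let f : P.complex.X 1 ⟶ ModuleCat.of A (LinearMap.ker p) :=
    ModuleCat.ofHom (LinearMap.codRestrict _ (P.complex.d 1 0 ≫ ψ₀).hom
      (fun x => ConcreteCategory.congr_hom hd x))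
  have hf : f ≫ ι = P.complex.d 1 0 ≫ ψ₀ := by
    ext x
    rfl
  obtain ⟨g, hg⟩ := hK f (by
    rw [← cancel_mono ι, Category.assoc, hf]
    simp)
  change P.complex.d 1 0 ≫ g = f at hg
  have hk : P.complex.d 1 0 ≫ (ψ₀ - g ≫ ι) = 0 := by
    rw [Preadditive.comp_sub, reassoc_of% hg, hf, sub_self]
  have : Epi ε := inferInstanceAs (Epi (P.π.f 0))
  let ψ : ModuleCat.of A C ⟶ ModuleCat.of A F :=
    P.isColimitCokernelCofork.desc (Limits.CokernelCofork.ofπ _ hk)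
  have hψ : ε ≫ ψ = ψ₀ - g ≫ ι :=
    P.isColimitCokernelCofork.fac (Limits.CokernelCofork.ofπ _ hk)
      Limits.WalkingParallelPair.one
  have key : ψ ≫ q = ModuleCat.ofHom φ := by
    rw [← cancel_epi ε, reassoc_of% hψ]
    simp [hψ₀, hιq]
  exact ⟨ψ.hom, congrArg ModuleCat.Hom.hom key⟩

theorem ext1_pi_subsingleton {M : Type} [AddCommGroup M] [Module A M] (n r : ℕ)
    (Y : Type) [AddCommGroup Y] [Module A Y] (hY : Subsingleton (ext1 A n M Y)) :
    Subsingleton (ext1 A n M (Fin r → Y)) := by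
  obtain ⟨P⟩ : Nonempty (ProjectiveResolution (ModuleCat.of A M)) :=
    HasProjectiveResolution.out
  rw [subsingleton_ext1_iff_s17 P] at hY ⊢
  intro f hf
  let π (i : Fin r) : ModuleCat.of A (Fin r → Y) ⟶ ModuleCat.of A Y :=
    ModuleCat.ofHom (LinearMap.proj i)
  have h (i : Fin r) := hY (f ≫ π i) (by rw [reassoc_of% hf, Limits.zero_comp])
  choose g hg using h
  refine ⟨ModuleCat.ofHom (LinearMap.pi fun i => (g i).hom), ?_⟩
  ext x i
  exact ConcreteCategory.congr_hom (hg i) x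

end ExtVanishing

section StablyIso

variable {R : Type} [CommRing R]

/-- `f` factors through a finitely generated free module. -/
def FactorsThroughFree {M N : Type} [AddCommGroup M] [Module R M]
    [AddCommGroup N] [Module R N] (f : M →ₗ[R] N) : Prop :=
  ∃ (r : ℕ) (α : M →ₗ[R] (Fin r → R)) (β : (Fin r → R) →ₗ[R] N), β ∘ₗ α = f

/-- `M` and `N` are isomorphic modulo maps factoring through finitely generated free modules. -/
def StablyIso (R : Type) [CommRing R] (M N : Type) [AddCommGroup M] [Module R M]
    [AddCommGroup N] [Module R N] : Prop :=
  ∃ (f : M →ₗ[R] N) (g : N →ₗ[R] M),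
    FactorsThroughFree (g ∘ₗ f - LinearMap.id) ∧ FactorsThroughFree (f ∘ₗ g - LinearMap.id)

theorem FactorsThroughFree.comp_left {L M N : Type} [AddCommGroup L] [Module R L]
    [AddCommGroup M] [Module R M] [AddCommGroup N] [Module R N] {f : L →ₗ[R] M}
    (hf : FactorsThroughFree f) (g : M →ₗ[R] N) : FactorsThroughFree (g ∘ₗ f) := by
  obtain ⟨r, α, β, rfl⟩ := hf
  exact ⟨r, α, g ∘ₗ β, rfl⟩

theorem StablyIso.refl (M : Type) [AddCommGroup M] [Module R M] : StablyIso R M M :=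
  ⟨LinearMap.id, LinearMap.id, ⟨0, 0, 0, by ext; simp⟩, ⟨0, 0, 0, by ext; simp⟩⟩

end StablyIso

section MCM

variable {R : Type} [CommRing R] [IsLocalRing R] {d : ℕ}

theorem le_rdepth_iff {M : Type} [AddCommGroup M] [Module R M] :
    (d : ℕ∞) ≤ rdepth R M ↔
      ∀ m < d, Subsingleton (ext1 R m (IsLocalRing.ResidueField R) M) := by
  unfold rdepth
  rw [le_sInf_iff]
  constructor
  · intro h m hm
    by_contra hc
    exact absurd (h m ⟨m, rfl, hc⟩) (by simpa using hm)
  · rintro h _ ⟨m, rfl, hm⟩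
    by_contra hc
    exact hm (h m (by simpa using hc))

theorem isMCM_pi (hCM : (d : ℕ∞) ≤ rdepth R R) (r : ℕ) : IsMCM R d (Fin r → R) :=
  ⟨inferInstance, le_rdepth_iff.2 fun m hm =>
    ext1_pi_subsingleton m r R (le_rdepth_iff.1 hCM m hm)⟩

theorem IsMCM.ker [IsNoetherianRing R] {F X : Type} [AddCommGroup F] [Module R F]
    [AddCommGroup X] [Module R X] (hF : IsMCM R d F) (hX : IsMCM R d X)
    (p : F →ₗ[R] X) (hp : Function.Surjective p) : IsMCM R d (LinearMap.ker p) := by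
  have := hF.1
  refine ⟨inferInstance, le_rdepth_iff.2 fun m hm => ?_⟩
  exact ext1_ker_subsingleton p hp m (le_rdepth_iff.1 hF.2 m hm)
    fun k hk => le_rdepth_iff.1 hX.2 k (by omega)

theorem IsMCM.factorsThroughFree [IsNoetherianRing R] (hCM : (d : ℕ∞) ≤ rdepth R R)
    {C X : Type} [AddCommGroup C] [Module R C] [AddCommGroup X] [Module R X]
    (hC : ∀ (Z : Type) [AddCommGroup Z] [Module R Z], IsMCM R d Z → Subsingleton (ext1 R 1 C Z))
    (hX : IsMCM R d X) (φ : C →ₗ[R] X) : FactorsThroughFree φ := by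
  have := hX.1
  obtain ⟨r, p, hp⟩ := Module.Finite.exists_fin' R X
  obtain ⟨ψ, hψ⟩ := exists_lift_of_ext1_ker_subsingleton p hp
    (hC _ ((isMCM_pi hCM r).ker hX p hp)) φ
  exact ⟨r, ψ, p, hψ⟩

/-- Lifts to preenvelopes of an endomorphism that is the identity modulo free modules induce an
endomorphism of the cokernel with the same property. -/
theorem IsSpecialCMPreenvelope.factorsThroughFree_sub_id [IsNoetherianRing R]
    (hCM : (d : ℕ∞) ≤ rdepth R R) {M X : Type} [AddCommGroup M] [Module R M]
    [AddCommGroup X] [Module R X] {μ : M →ₗ[R] X} (hμ : IsSpecialCMPreenvelope R d μ)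
    {e : M →ₗ[R] M} (he : FactorsThroughFree (e - LinearMap.id)) {e' : X →ₗ[R] X}
    (hcomm : e' ∘ₗ μ = μ ∘ₗ e)
    (c : (X ⧸ LinearMap.range μ) →ₗ[R] (X ⧸ LinearMap.range μ))
    (hc : c ∘ₗ (LinearMap.range μ).mkQ = (LinearMap.range μ).mkQ ∘ₗ e') :
    FactorsThroughFree (c - LinearMap.id) := by
  obtain ⟨r, α, β, hαβ⟩ := he
  obtain ⟨α', rfl⟩ := hμ.1.2 _ (isMCM_pi hCM r) α
  have hle : LinearMap.range μ ≤
      LinearMap.ker (e' - LinearMap.id - μ ∘ₗ β ∘ₗ α') := by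
    rintro _ ⟨x, rfl⟩
    have h1 := LinearMap.congr_fun hcomm x
    have h2 := congrArg μ (LinearMap.congr_fun hαβ x)
    simp only [LinearMap.comp_apply, LinearMap.sub_apply, LinearMap.id_apply, map_sub] at h1 h2
    simp [h1, h2]
  let γ := (LinearMap.range μ).liftQ _ hle
  have hγ : (LinearMap.range μ).mkQ ∘ₗ γ = c - LinearMap.id := by
    refine Submodule.linearMap_qext _ (LinearMap.ext fun x => ?_)
    have h1 := LinearMap.congr_fun hc x
    simp only [LinearMap.comp_apply] at h1
    have h2 : (LinearMap.range μ).mkQ (μ (β (α' x))) = 0 := by simp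
    simp only [γ, LinearMap.comp_apply, LinearMap.sub_apply, LinearMap.id_apply,
      Submodule.mkQ_apply, Submodule.liftQ_apply, Submodule.Quotient.mk_sub] at h1 h2 ⊢
    rw [h1, h2, sub_zero]
  rw [← hγ]
  exact (hμ.1.1.factorsThroughFree hCM hμ.2 γ).comp_left _

theorem StablyIso.coker [IsNoetherianRing R] (hCM : (d : ℕ∞) ≤ rdepth R R)
    {M X M' X' : Type} [AddCommGroup M] [Module R M] [AddCommGroup X] [Module R X]
    [AddCommGroup M'] [Module R M'] [AddCommGroup X'] [Module R X']
    (h : StablyIso R M M') {μ : M →ₗ[R] X} {μ' : M' →ₗ[R] X'}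
    (hμ : IsSpecialCMPreenvelope R d μ) (hμ' : IsSpecialCMPreenvelope R d μ') :
    StablyIso R (X ⧸ LinearMap.range μ) (X' ⧸ LinearMap.range μ') := by
  obtain ⟨f, g, hgf, hfg⟩ := h
  obtain ⟨f', hf'⟩ := hμ.1.2 _ hμ'.1.1 (μ' ∘ₗ f)
  obtain ⟨g', hg'⟩ := hμ'.1.2 _ hμ.1.1 (μ ∘ₗ g)
  let fc : (X ⧸ LinearMap.range μ) →ₗ[R] (X' ⧸ LinearMap.range μ') :=
    Submodule.mapQ _ _ f' (by
      rintro _ ⟨x, rfl⟩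
      exact ⟨f x, (LinearMap.congr_fun hf' x).symm⟩)
  let gc : (X' ⧸ LinearMap.range μ') →ₗ[R] (X ⧸ LinearMap.range μ) :=
    Submodule.mapQ _ _ g' (by
      rintro _ ⟨x, rfl⟩
      exact ⟨g x, (LinearMap.congr_fun hg' x).symm⟩)
  refine ⟨fc, gc, hμ.factorsThroughFree_sub_id hCM hgf (e' := g' ∘ₗ f') ?_ _ ?_,
    hμ'.factorsThroughFree_sub_id hCM hfg (e' := f' ∘ₗ g') ?_ _ ?_⟩
  · rw [LinearMap.comp_assoc, hf', ← LinearMap.comp_assoc, hg', LinearMap.comp_assoc]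
  · ext x
    rfl
  · rw [LinearMap.comp_assoc, hg', ← LinearMap.comp_assoc, hf', LinearMap.comp_assoc]
  · ext x
    rfl

/-- Over a local ring, stably isomorphic finite modules agree up to free direct summands. -/
theorem StablyIso.exists_prod_equiv {C C' : Type} [AddCommGroup C] [Module R C]
    [AddCommGroup C'] [Module R C'] [Module.Finite R C'] (h : StablyIso R C C') :
    ∃ (F F' : ModuleCat.{0} R),
      Module.Free R F ∧ Module.Finite R F ∧ Module.Free R F' ∧ Module.Finite R F' ∧
      Nonempty ((C × F) ≃ₗ[R] (C' × F')) := by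
  obtain ⟨f, g, ⟨r, α, β, hαβ⟩, ⟨s, γ, δ, hγδ⟩⟩ := h
  let i : C →ₗ[R] C' × (Fin r → R) := f.prod α
  let p : C' × (Fin r → R) →ₗ[R] C := g.coprod (-β)
  have hpi : p ∘ₗ i = LinearMap.id := by
    ext x
    have := LinearMap.congr_fun hαβ x
    simp only [LinearMap.comp_apply, LinearMap.sub_apply, LinearMap.id_apply] at this
    simp [p, i, this]
  let Q := LinearMap.ker p
  have hpi' (x : C) : p (i x) = x := LinearMap.congr_fun hpi x
  let ρ : C' × (Fin r → R) →ₗ[R] Q :=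
    (LinearMap.id - i ∘ₗ p).codRestrict Q fun x => by simp [Q, hpi']
  have hρ (q : Q) : ρ q = q := by
    ext1
    have : p q = 0 := q.2
    simp [ρ, this]
  have hρi (x : C) : ρ (i x) = 0 := by
    ext1
    simp [ρ, hpi']
  let e : (C × Q) ≃ₗ[R] (C' × (Fin r → R)) :=
    LinearEquiv.ofLinearMap (i.coprod Q.subtype) (p.prod ρ)
      (by
        refine LinearMap.ext fun x => ?_
        simp [ρ])
      (by
        refine LinearMap.ext fun x => ?_
        have h2 : p x.2 = 0 := x.2.2
        refine Prod.ext ?_ ?_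
        · simp [hpi', h2]
        · simp [hρ, hρi])
  have hfin : Module.Finite R Q := Module.Finite.of_surjective ρ fun q => ⟨q, hρ q⟩
  -- the identity of `Q` factors through `R^s × R^r`
  let a : Q →ₗ[R] (Fin s → R) × (Fin r → R) :=
    (γ ∘ₗ LinearMap.fst R C' _).prod (LinearMap.snd R C' _ - α ∘ₗ g ∘ₗ LinearMap.fst R C' _)
      ∘ₗ Q.subtype
  let b : (Fin s → R) × (Fin r → R) →ₗ[R] Q :=
    ρ ∘ₗ (LinearMap.inl R C' _ ∘ₗ (-δ)).coprod (LinearMap.inr R C' _)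
  have hba : b ∘ₗ a = LinearMap.id := by
    refine LinearMap.ext fun q => ?_
    have h1 := LinearMap.congr_fun hγδ q.1.1
    simp only [LinearMap.comp_apply, LinearMap.sub_apply, LinearMap.id_apply] at h1
    have h2 : (q : C' × (Fin r → R)) - i (g q.1.1) = (-δ (γ q.1.1), q.1.2 - α (g q.1.1)) := by
      refine Prod.ext ?_ ?_
      · simp [i, h1]
      · simp [i]
    calc b (a q) = ρ (-δ (γ q.1.1), q.1.2 - α (g q.1.1)) := by simp [a, b]
      _ = q := by rw [← h2, map_sub, hρi, sub_zero, hρ]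
  have : Module.Projective R Q := Module.Projective.of_split a b hba
  have hfree : Module.Free R Q := Module.free_of_flat_of_isLocalRing
  exact ⟨ModuleCat.of R Q, ModuleCat.of R (Fin r → R), hfree, hfin,
    inferInstanceAs (Module.Free R (Fin r → R)), inferInstanceAs (Module.Finite R (Fin r → R)),
    ⟨e⟩⟩

end MCM

/-- over a Henselian CM local ring, the cokernels of the induced maps of two
special proper CM-coresolutions of `M` agree up to free direct summands. -/
theorem coker_unique_up_to_free_summands (R : Type) [CommRing R] [IsNoetherianRing R]
    [HenselianLocalRing R]
    (d : ℕ) (hdim : ringKrullDim R = d) (hCM : (d : ℕ∞) ≤ rdepth R R)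
    (ω : Type) [AddCommGroup ω] [Module R ω] (hω : IsCanonicalModule R d ω)
    (M : Type) [AddCommGroup M] [Module R M] [Module.Finite R M]
    (X : ℕ → ModuleCat.{0} R)
    (d0 : M →ₗ[R] ↥(X 0)) (dn : ∀ i, ↥(X i) →ₗ[R] ↥(X (i+1)))
    (hc0 : LinearMap.range d0 ≤ LinearMap.ker (dn 0))
    (hc : ∀ i, LinearMap.range (dn i) ≤ LinearMap.ker (dn (i+1)))
    (hres : IsSpecialProperCMCoresolution R M X d0 dn hc0 hc d)
    (X' : ℕ → ModuleCat.{0} R)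
    (d0' : M →ₗ[R] ↥(X' 0)) (dn' : ∀ i, ↥(X' i) →ₗ[R] ↥(X' (i+1)))
    (hc0' : LinearMap.range d0' ≤ LinearMap.ker (dn' 0))
    (hc' : ∀ i, LinearMap.range (dn' i) ≤ LinearMap.ker (dn' (i+1)))
    (hres' : IsSpecialProperCMCoresolution R M X' d0' dn' hc0' hc' d) :
    ∀ i : ℕ, ∃ (F F' : ModuleCat.{0} R),
      Module.Free R ↥F ∧ Module.Finite R ↥F ∧ Module.Free R ↥F' ∧ Module.Finite R ↥F' ∧
      Nonempty
        (((↥(X i) ⧸ LinearMap.range (muAt R M X d0 dn hc0 hc i)) × ↥F) ≃ₗ[R]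
          ((↥(X' i) ⧸ LinearMap.range (muAt R M X' d0' dn' hc0' hc' i)) × ↥F')) := by
  have key : ∀ i, StablyIso R (cokerAt R M X d0 dn i) (cokerAt R M X' d0' dn' i) := by
    intro i
    induction i with
    | zero => exact StablyIso.refl M
    | succ i ih =>
      have h := ih.coker hCM (hres.2 i) (hres'.2 i)
      rcases i with _ | _ | i
      · exact h
      · have e : LinearMap.range (muAt R M X d0 dn hc0 hc 1) = LinearMap.range (dn 0) :=
          Submodule.range_liftQ _ _ _
        have e' : LinearMap.range (muAt R M X' d0' dn' hc0' hc' 1) = LinearMap.range (dn' 0) :=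
          Submodule.range_liftQ _ _ _
        rw [e, e'] at h
        exact h
      · have e : LinearMap.range (muAt R M X d0 dn hc0 hc (i + 2)) = LinearMap.range (dn (i + 1)) :=
          Submodule.range_liftQ _ _ _
        have e' : LinearMap.range (muAt R M X' d0' dn' hc0' hc' (i + 2)) =
            LinearMap.range (dn' (i + 1)) :=
          Submodule.range_liftQ _ _ _
        rw [e, e'] at h
        exact h
  intro i
  have := (hres'.1 i).1
  exact ((key i).coker hCM (hres.2 i) (hres'.2 i)).exists_prod_equiv
end
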